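/- arXiv:1404.1185 — 2 statements merged into one kernel-verified Lean document; each statement's English description precedes it below -/
import Mathlib

section
/- Let $Y_i$, $i \in \mathbb{N}$, be Banach spaces and $Y = (\bigoplus_{i=1}^\infty Y_i)_{c_0}$ their $c_0$-sum. If each $Y_i$ is separable and isomorphically polyhedral, then $Y$ is separable and isomorphically polyhedral. -/
open NormedSpace Filter
open scoped ENNReal

/-- A normed space is polyhedral if the unit ball of every finite-dimensional
subspace is a polytope, i.e. has finitely many extreme points. -/
def IsPolyhedral (X : Type*) [NormedAddCommGroup X] [NormedSpace ℝ X] : Prop :=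
  ∀ S : Subspace ℝ X, FiniteDimensional ℝ S →
    (Set.extremePoints ℝ (Metric.closedBall (0 : S) 1)).Finite

/-- A normed space is isomorphically polyhedral if it is isomorphic to a polyhedral space. -/
def IsIsomorphicallyPolyhedral (X : Type u) [NormedAddCommGroup X] [NormedSpace ℝ X] : Prop :=
  ∃ (Y : Type u) (_ : NormedAddCommGroup Y) (_ : NormedSpace ℝ Y),
    IsPolyhedral Y ∧ Nonempty (X ≃L[ℝ] Y)

/-- The `c₀`-sum of a sequence of normed spaces, as a subspace of the `ℓ∞`-sum:
bounded sequences `(y i)` with `‖y i‖ → 0`, under the sup norm. -/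
noncomputable def c0Sum (E : ℕ → Type*) [∀ i, NormedAddCommGroup (E i)] [∀ i, NormedSpace ℝ (E i)] :
    Submodule ℝ (lp E ∞) where
  carrier := {f | Tendsto (fun i => ‖f i‖) atTop (nhds 0)}
  zero_mem' := by simpa using (tendsto_const_nhds : Tendsto (fun _ : ℕ => (0:ℝ)) atTop _)
  add_mem' := by
    intro f g hf hg
    refine squeeze_zero (fun i => norm_nonneg _) (fun i => ?_) (by simpa using hf.add hg)
    simpa using norm_add_le (f i) (g i)
  smul_mem' := by
    intro c f hf
    refine squeeze_zero (fun i => norm_nonneg _) (fun i => ?_)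
      (by simpa using hf.const_mul ‖c‖)
    simp [norm_smul]

open scoped Topology

/-- A polyhedron cut out by finitely many linear inequalities has finitely many extreme points. -/
lemma finite_extremePoints_of_finite_ineq {E : Type*} [AddCommGroup E] [Module ℝ E]
    {Φ : Set (E →ₗ[ℝ] ℝ)} (hΦ : Φ.Finite) :
    (Set.extremePoints ℝ {z : E | ∀ f ∈ Φ, f z ≤ 1}).Finite := by
  refine Set.Finite.of_injOn (f := fun z => {f ∈ Φ | f z = 1}) (t := Φ.powerset)
    (fun z _ => Set.sep_subset _ _) ?_ hΦ.finite_subsets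
  intro z hz z' hz' hzz'
  by_contra hne
  have hev : ∀ᶠ s : ℝ in 𝓝 0, ∀ f ∈ Φ,
      f (z + s • (z - z')) ≤ 1 ∧ f (z - s • (z - z')) ≤ 1 := by
    rw [Filter.eventually_all_finite hΦ]
    intro f hf
    simp only [map_add, map_sub, map_smul, smul_eq_mul]
    rcases eq_or_lt_of_le (hz.1 f hf) with h1 | h1
    · have h2 : f ∈ {f ∈ Φ | f z' = 1} := by
        rw [← show {f ∈ Φ | f z = 1} = {f ∈ Φ | f z' = 1} from hzz']
        exact ⟨hf, h1⟩
      refine Filter.Eventually.of_forall fun s => ?_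
      rw [h1, h2.2]
      simp
    · have c1 : ContinuousAt (fun s : ℝ => f z + s * (f z - f z')) 0 := by fun_prop
      have c2 : ContinuousAt (fun s : ℝ => f z - s * (f z - f z')) 0 := by fun_prop
      filter_upwards [c1.eventually_lt_const (u := 1) (by simpa using h1),
        c2.eventually_lt_const (u := 1) (by simpa using h1)] with s h3 h4
      exact ⟨h3.le, h4.le⟩
  have hev2 : ∀ᶠ s : ℝ in 𝓝[>] 0, ∀ f ∈ Φ,
      f (z + s • (z - z')) ≤ 1 ∧ f (z - s • (z - z')) ≤ 1 := hev.filter_mono nhdsWithin_le_nhds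
  obtain ⟨s, hs, hs0⟩ := (hev2.and self_mem_nhdsWithin).exists
  have h5 := (mem_extremePoints.1 hz).2 _ (fun f hf => (hs f hf).1) _ (fun f hf => (hs f hf).2)
    ⟨1 / 2, 1 / 2, by norm_num, by norm_num, by norm_num, by module⟩
  have h6 : s • (z - z') = 0 := by simpa using h5.1
  rcases smul_eq_zero.1 h6 with h7 | h7
  · exact (ne_of_gt hs0) h7
  · exact hne (sub_eq_zero.1 h7)

/-- If the unit ball of a finite-dimensional space has finitely many extreme points, the norm is
a maximum of finitely many linear functionals. -/
lemma exists_finite_norming {S : Type*} [NormedAddCommGroup S] [NormedSpace ℝ S]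
    [FiniteDimensional ℝ S] (h : (Set.extremePoints ℝ (Metric.closedBall (0 : S) 1)).Finite) :
    ∃ Φ : Set (S →L[ℝ] ℝ), Φ.Finite ∧ (∀ f ∈ Φ, ∀ z, f z ≤ ‖z‖) ∧ ∀ z, ∃ f ∈ Φ, f z = ‖z‖ := by
  have : ProperSpace S := FiniteDimensional.proper ℝ S
  have : ProperSpace (S →L[ℝ] ℝ) := FiniteDimensional.proper ℝ _
  set F := Set.extremePoints ℝ (Metric.closedBall (0 : S) 1) with hF
  set D : Set (S →L[ℝ] ℝ) := Metric.closedBall 0 1 with hD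
  have hDle : ∀ f ∈ D, ∀ z, f z ≤ ‖z‖ := fun f hf z => by
    have := f.le_of_opNorm_le (mem_closedBall_zero_iff.1 hf) z
    rw [one_mul] at this
    exact (Real.le_norm_self _).trans this
  have hDeq : D = {f : S →L[ℝ] ℝ | ∀ φ ∈ (fun e : S =>
      ((ContinuousLinearMap.apply ℝ ℝ e : (S →L[ℝ] ℝ) →L[ℝ] ℝ) :
        (S →L[ℝ] ℝ) →ₗ[ℝ] ℝ)) '' F, φ f ≤ 1} := by
    ext f
    simp only [Set.forall_mem_image, Set.mem_ofPred_eq, ContinuousLinearMap.coe_coe,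
      ContinuousLinearMap.apply_apply]
    constructor
    · intro hf e he
      exact (hDle f hf e).trans (mem_closedBall_zero_iff.1 he.1)
    · intro hf
      have hsub : Metric.closedBall (0 : S) 1 ⊆ {z | f z ≤ 1} := by
        rw [← closure_convexHull_extremePoints (isCompact_closedBall (0 : S) 1)
          (convex_closedBall 0 1)]
        refine closure_minimal (convexHull_min (fun e he => hf he) ?_) ?_
        · exact convex_halfSpace_le f.isLinear 1
        · exact isClosed_le f.continuous continuous_const
      refine mem_closedBall_zero_iff.2 (f.opNorm_le_of_unit_norm zero_le_one fun z hz => ?_)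
      rw [Real.norm_eq_abs, abs_le]
      have h1 : f z ≤ 1 := hsub (by simp [hz])
      have h2 : f (-z) ≤ 1 := hsub (by simp [hz])
      rw [map_neg] at h2
      constructor <;> linarith
  refine ⟨Set.extremePoints ℝ D, ?_, fun f hf => hDle f hf.1, fun z => ?_⟩
  · rw [hDeq]
    exact finite_extremePoints_of_finite_ineq (h.image _)
  · obtain ⟨g, hg, hgz⟩ := exists_dual_vector'' ℝ z
    have hexp : IsExposed ℝ D {f ∈ D | ∀ f' ∈ D, f' z ≤ f z} :=
      fun _ => ⟨ContinuousLinearMap.apply ℝ ℝ z, rfl⟩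
    have hgD : g ∈ D := mem_closedBall_zero_iff.2 hg
    have hne : {f ∈ D | ∀ f' ∈ D, f' z ≤ f z}.Nonempty :=
      ⟨g, hgD, fun f' hf' => (hDle f' hf' z).trans hgz.ge⟩
    obtain ⟨f, hf⟩ := (hexp.isCompact (isCompact_closedBall _ _)).extremePoints_nonempty hne
    exact ⟨f, hexp.isExtreme.extremePoints_subset_extremePoints hf,
      le_antisymm (hDle f hf.1.1 z) (hgz.ge.trans (hf.1.2 g hgD))⟩

/-- A polyhedral norm is affine on a short segment issuing from `x` in the direction `y`. -/
lemma IsPolyhedral.exists_affine {X : Type*} [NormedAddCommGroup X] [NormedSpace ℝ X]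
    (hX : IsPolyhedral X) (x y : X) :
    ∃ d : ℝ, ∃ δ > 0, ∀ t ∈ Set.Icc (0 : ℝ) δ, ‖x + t • y‖ = ‖x‖ + t * d := by
  let S : Submodule ℝ X := Submodule.span ℝ {x, y}
  have hfin : FiniteDimensional ℝ S := FiniteDimensional.span_of_finite ℝ (by simp)
  obtain ⟨Φ, hΦ, hle, heq⟩ := exists_finite_norming (hX S hfin)
  let x' : S := ⟨x, Submodule.subset_span (by simp)⟩
  let y' : S := ⟨y, Submodule.subset_span (by simp)⟩
  obtain ⟨f₁, hf₁, hfx₁⟩ := heq x'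
  obtain ⟨f₀, ⟨hf₀, hfx₀⟩, hmax⟩ := Set.exists_max_image {f ∈ Φ | f x' = ‖x'‖} (fun f => f y')
    (hΦ.subset (Set.sep_subset _ _)) ⟨f₁, hf₁, hfx₁⟩
  have hev : ∀ᶠ t : ℝ in 𝓝 0, ∀ f ∈ Φ, 0 ≤ t → f (x' + t • y') ≤ f₀ (x' + t • y') := by
    rw [Filter.eventually_all_finite hΦ]
    intro f hf
    simp only [map_add, map_smul, smul_eq_mul]
    rcases eq_or_lt_of_le (hle f hf x') with h1 | h1
    · refine Filter.Eventually.of_forall fun t ht => ?_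
      rw [h1, hfx₀]
      have := hmax f ⟨hf, h1⟩
      gcongr
    · have c1 : ContinuousAt (fun s : ℝ => f x' + s * f y') 0 := by fun_prop
      have c2 : ContinuousAt (fun s : ℝ => f₀ x' + s * f₀ y') 0 := by fun_prop
      filter_upwards [c1.eventually_lt c2 (by simpa [hfx₀] using h1)] with t ht _ using ht.le
  obtain ⟨δ, hδ, hball⟩ := Metric.eventually_nhds_iff.1 hev
  refine ⟨f₀ y', δ / 2, by positivity, fun t ht => ?_⟩
  obtain ⟨f, hf, hft⟩ := heq (x' + t • y')
  have hdist : dist t 0 < δ := by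
    rw [Real.dist_0_eq_abs, abs_of_nonneg ht.1]
    linarith [ht.2]
  have h2 := hball hdist f hf ht.1
  have h3 := hle f₀ hf₀ (x' + t • y')
  have h4 : f₀ (x' + t • y') = ‖x' + t • y'‖ := le_antisymm h3 (hft.ge.trans h2)
  rw [map_add, map_smul, hfx₀, smul_eq_mul] at h4
  exact h4.symm

/-- In a complete polyhedral space, for each `x` the norm is affine on segments of a common
length issuing from `x` in all directions from a nonempty open set. -/
lemma IsPolyhedral.exists_isOpen_affine {X : Type*} [NormedAddCommGroup X] [NormedSpace ℝ X]
    [CompleteSpace X] (hX : IsPolyhedral X) (x : X) :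
    ∃ δ > 0, ∃ O : Set X, IsOpen O ∧ O.Nonempty ∧ ∀ y ∈ O, ∀ t ∈ Set.Icc (0 : ℝ) δ,
      ‖x + t • y‖ = ‖x‖ + t * ((‖x + δ • y‖ - ‖x‖) / δ) := by
  let δ : ℕ → ℝ := fun k => 1 / ((k : ℝ) + 1)
  have hδ : ∀ k, 0 < δ k := fun k => Nat.one_div_pos_of_nat
  let A : ℕ → Set X := fun k => {y | ∀ t ∈ Set.Icc (0 : ℝ) (δ k),
      ‖x + t • y‖ = ‖x‖ + t * ((‖x + δ k • y‖ - ‖x‖) / δ k)}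
  have hA : ∀ k, IsClosed (A k) := by
    intro k
    have : A k = ⋂ t ∈ Set.Icc (0 : ℝ) (δ k),
        {y | ‖x + t • y‖ = ‖x‖ + t * ((‖x + δ k • y‖ - ‖x‖) / δ k)} := by
      ext y
      simp [A]
    rw [this]
    refine isClosed_biInter fun t _ => isClosed_eq (by fun_prop) ?_
    have : Continuous fun y : X => ‖x + δ k • y‖ - ‖x‖ := by fun_prop
    exact continuous_const.add (continuous_const.mul (this.div_const _))
  have hU : ⋃ k, A k = Set.univ := by
    refine Set.eq_univ_of_forall fun y => ?_
    obtain ⟨d, η, hη, hd⟩ := hX.exists_affine x y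
    obtain ⟨k, hk⟩ := exists_nat_one_div_lt hη
    refine Set.mem_iUnion.2 ⟨k, fun t ht => ?_⟩
    rw [hd t ⟨ht.1, ht.2.trans hk.le⟩, hd (δ k) ⟨(hδ k).le, hk.le⟩]
    have := (hδ k).ne'
    field_simp
    ring
  obtain ⟨k, hk⟩ := nonempty_interior_of_iUnion_of_closed hA hU
  exact ⟨δ k, hδ k, interior (A k), isOpen_interior, hk, fun y hy => interior_subset hy⟩

/-- On each short segment in the direction `y` there is a point at which the second difference
of the norm is small. -/
lemma exists_second_difference_lt {X : Type*} [NormedAddCommGroup X] [NormedSpace ℝ X]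
    (x y : X) {δ η c : ℝ} (hδ : 0 < δ) (hη : 0 < η) (hc : 0 < c) :
    ∃ s ∈ Set.Icc (0 : ℝ) δ, ∃ t ∈ Set.Ioo (0 : ℝ) η,
      ‖x + s • y + t • y‖ + ‖x + s • y - t • y‖ - 2 * ‖x + s • y‖ < t * c := by
  by_contra! hcon
  obtain ⟨N, hN⟩ := exists_nat_gt (max (2 * ‖y‖ / c) (δ / η))
  have hN1 : 2 * ‖y‖ / c < N := (le_max_left _ _).trans_lt hN
  have hN2 : δ / η < N := (le_max_right _ _).trans_lt hN
  have hN0 : (0 : ℝ) < N := (div_pos hδ hη).trans hN2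
  set t := δ / N with ht
  have ht0 : 0 < t := div_pos hδ hN0
  have htη : t < η := by
    rw [ht, div_lt_iff₀ hN0]
    rw [div_lt_iff₀ hη] at hN2
    linarith
  have key : ∀ i : ℕ, i ≤ N → -(t * ‖y‖) + (i + 1) * (t * c) ≤
      ‖x + (((i : ℝ) + 1) * t) • y‖ - ‖x + ((i : ℝ) * t) • y‖ := by
    intro i
    induction i with
    | zero =>
      intro _
      have h1 := hcon 0 ⟨le_rfl, hδ.le⟩ t ⟨ht0, htη⟩
      have h2 : ‖x‖ ≤ ‖x - t • y‖ + t * ‖y‖ := by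
        have := norm_add_le (x - t • y) (t • y)
        rwa [sub_add_cancel, norm_smul, Real.norm_eq_abs, abs_of_pos ht0] at this
      have h3 : ‖x - t • y‖ ≤ ‖x‖ + t * ‖y‖ := by
        have := norm_sub_le x (t • y)
        rwa [norm_smul, Real.norm_eq_abs, abs_of_pos ht0] at this
      simp only [zero_smul, add_zero, Nat.cast_zero, zero_mul, zero_add, one_mul] at h1 ⊢
      linarith
    | succ i ih =>
      intro hi
      have h0 := ih (by omega)
      have hi' : ((i : ℝ) + 1) ≤ N := by exact_mod_cast hi
      have h1 := hcon (((i : ℝ) + 1) * t) ⟨by positivity, by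
        calc ((i : ℝ) + 1) * t ≤ N * t := by gcongr
          _ = δ := by rw [ht]; field_simp⟩ t ⟨ht0, htη⟩
      have e1 : x + (((i : ℝ) + 1) * t) • y + t • y = x + (((i : ℝ) + 1 + 1) * t) • y := by module
      have e2 : x + (((i : ℝ) + 1) * t) • y - t • y = x + ((i : ℝ) * t) • y := by module
      rw [e1, e2] at h1
      push_cast
      linarith
  have h1 := key N le_rfl
  have h2 : ‖x + (((N : ℝ) + 1) * t) • y‖ ≤ ‖x + ((N : ℝ) * t) • y‖ + t * ‖y‖ := by
    have := norm_add_le (x + ((N : ℝ) * t) • y) (t • y)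
    rw [norm_smul, Real.norm_eq_abs, abs_of_pos ht0] at this
    rwa [show x + (((N : ℝ) + 1) * t) • y = x + ((N : ℝ) * t) • y + t • y by module]
  have h3 : (N + 1) * c ≤ 2 * ‖y‖ := by
    have : t * ((N + 1) * c) ≤ t * (2 * ‖y‖) := by linarith
    exact le_of_mul_le_mul_left this ht0
  rw [div_lt_iff₀ hc] at hN1
  linarith

/-- The norm of a separable Banach space has small second differences, in all directions, on a
dense set of points. -/
lemma dense_second_difference {X : Type*} [NormedAddCommGroup X] [NormedSpace ℝ X]
    [CompleteSpace X] [TopologicalSpace.SeparableSpace X] :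
    Dense {x : X | ∀ y : X, ∀ ε > 0, ∃ t ∈ Set.Ioo (0 : ℝ) ε,
      ‖x + t • y‖ + ‖x - t • y‖ - 2 * ‖x‖ ≤ t * ε} := by
  let u := TopologicalSpace.denseSeq X
  let G : ℕ × ℕ → Set X := fun p => ⋃ t ∈ Set.Ioo (0 : ℝ) (1 / ((p.2 : ℝ) + 1)),
    {x | ‖x + t • u p.1‖ + ‖x - t • u p.1‖ - 2 * ‖x‖ < t * (1 / ((p.2 : ℝ) + 1))}
  have hopen : ∀ p, IsOpen (G p) := fun p =>
    isOpen_biUnion fun t _ => isOpen_lt (by fun_prop) continuous_const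
  have hdense : ∀ p, Dense (G p) := by
    intro p
    rw [Metric.dense_iff]
    intro x r hr
    have hp : (0 : ℝ) < 1 / ((p.2 : ℝ) + 1) := Nat.one_div_pos_of_nat
    obtain ⟨s, hs, t, ht, hst⟩ := exists_second_difference_lt x (u p.1)
      (δ := r / (2 * (‖u p.1‖ + 1))) (by positivity) hp hp
    refine ⟨x + s • u p.1, ?_, Set.mem_biUnion ht hst⟩
    rw [Metric.mem_ball, dist_self_add_left, norm_smul, Real.norm_eq_abs, abs_of_nonneg hs.1]
    calc s * ‖u p.1‖ ≤ r / (2 * (‖u p.1‖ + 1)) * (‖u p.1‖ + 1) := by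
          gcongr
          · exact hs.2
          · linarith
      _ = r / 2 := by field_simp
      _ < r := by linarith
  refine (dense_iInter_of_isOpen hopen hdense).mono fun x hx y ε hε => ?_
  obtain ⟨n, hn⟩ := exists_nat_one_div_lt (show 0 < ε / 3 by positivity)
  obtain ⟨j, hj⟩ := (TopologicalSpace.denseRange_denseSeq X).exists_dist_lt y
    (show 0 < ε / 3 by positivity)
  have h1 := Set.mem_iInter.1 hx (j, n)
  simp only [G, Set.mem_iUnion] at h1
  obtain ⟨t, ht, h2⟩ := h1
  have h2 : ‖x + t • u j‖ + ‖x - t • u j‖ - 2 * ‖x‖ < t * (1 / ((n : ℝ) + 1)) := h2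
  refine ⟨t, ⟨ht.1, by linarith [ht.2]⟩, ?_⟩
  have hd : ‖t • (y - u j)‖ ≤ t * (ε / 3) := by
    rw [norm_smul, Real.norm_eq_abs, abs_of_pos ht.1, ← dist_eq_norm]
    exact mul_le_mul_of_nonneg_left hj.le ht.1.le
  have h3 : ‖x + t • y‖ ≤ ‖x + t • u j‖ + ‖t • (y - u j)‖ := by
    have := norm_add_le (x + t • u j) (t • (y - u j))
    rwa [show x + t • u j + t • (y - u j) = x + t • y by module] at this
  have h4 : ‖x - t • y‖ ≤ ‖x - t • u j‖ + ‖t • (y - u j)‖ := by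
    have := norm_sub_le (x - t • u j) (t • (y - u j))
    rwa [show x - t • u j - t • (y - u j) = x - t • y by module] at this
  have h5 : t * (1 / ((n : ℝ) + 1)) ≤ t * (ε / 3) := mul_le_mul_of_nonneg_left hn.le ht.1.le
  linarith

/-- The functionals of norm at most one that agree with the norm on a nonempty open set. -/
def faceFunctionals (X : Type*) [NormedAddCommGroup X] [NormedSpace ℝ X] : Set (X →L[ℝ] ℝ) :=
  {f | (∀ y, |f y| ≤ ‖y‖) ∧ ∃ x, ∀ᶠ y in 𝓝 x, f y = ‖y‖}

lemma countable_faceFunctionals (X : Type*) [NormedAddCommGroup X] [NormedSpace ℝ X]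
    [TopologicalSpace.SeparableSpace X] : (faceFunctionals X).Countable := by
  refine Set.PairwiseDisjoint.countable_of_isOpen
    (s := fun f : X →L[ℝ] ℝ => interior {y | f y = ‖y‖}) ?_ (fun _ _ => isOpen_interior) ?_
  · intro f _ g _ hne
    refine Set.disjoint_left.2 fun x hxf hxg => hne ?_
    have hev : ∀ᶠ y in 𝓝 x, f y = g y := by
      filter_upwards [mem_interior_iff_mem_nhds.1 hxf, mem_interior_iff_mem_nhds.1 hxg]
        with y h1 h2
      exact Eq.trans h1 (Eq.symm h2)
    have hx := hev.self_of_nhds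
    ext v
    have ht : Tendsto (fun t : ℝ => x + t • v) (𝓝[>] 0) (𝓝 x) := by
      have : ContinuousAt (fun t : ℝ => x + t • v) 0 := by fun_prop
      have h := this.tendsto
      simp only [zero_smul, add_zero] at h
      exact h.mono_left nhdsWithin_le_nhds
    obtain ⟨t, h1, h2⟩ := ((ht.eventually hev).and self_mem_nhdsWithin).exists
    have h2 : 0 < t := h2
    simp only [map_add, map_smul, smul_eq_mul, hx] at h1
    exact mul_left_cancel₀ h2.ne' (add_left_cancel h1)
  · rintro f ⟨_, x, hx⟩
    exact ⟨x, mem_interior_iff_mem_nhds.2 hx⟩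

/-- In a separable polyhedral Banach space, every nonempty open set contains a point near which
the norm is linear. -/
lemma IsPolyhedral.dense_locally_linear {X : Type*} [NormedAddCommGroup X] [NormedSpace ℝ X]
    [CompleteSpace X] [TopologicalSpace.SeparableSpace X] (hX : IsPolyhedral X)
    {V : Set X} (hV : IsOpen V) (hne : V.Nonempty) :
    ∃ f ∈ faceFunctionals X, ∃ x ∈ V, ∀ᶠ y in 𝓝 x, f y = ‖y‖ := by
  obtain ⟨x, hx, hxV⟩ := dense_second_difference.exists_mem_open hV hne
  obtain ⟨f, hf1, hfx⟩ := exists_dual_vector'' ℝ x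
  have hfx : f x = ‖x‖ := hfx
  have hfle : ∀ y, |f y| ≤ ‖y‖ := fun y => by
    simpa using f.le_of_opNorm_le hf1 y
  obtain ⟨δ, hδ, O, hO, ⟨y₀, hy₀⟩, hlin⟩ := hX.exists_isOpen_affine x
  have hfd : ∀ y ∈ O, ∀ t ∈ Set.Icc (0 : ℝ) δ, f (x + t • y) = ‖x + t • y‖ := by
    intro y hy t ht
    rw [hlin y hy t ht, map_add, map_smul, hfx, smul_eq_mul]
    congr 2
    set d := (‖x + δ • y‖ - ‖x‖) / δ
    refine le_antisymm ?_ ?_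
    · have h1 := (le_abs_self _).trans (hfle (x + δ • y))
      rw [hlin y hy δ ⟨hδ.le, le_rfl⟩, map_add, map_smul, hfx, smul_eq_mul] at h1
      exact le_of_mul_le_mul_left (by linarith) hδ
    · refine le_of_forall_pos_le_add fun ε hε => ?_
      obtain ⟨s, hs, hsd⟩ := hx y (min ε δ) (lt_min hε hδ)
      have hsδ : s ≤ δ := hs.2.le.trans (min_le_right _ _)
      rw [hlin y hy s ⟨hs.1.le, hsδ⟩] at hsd
      have h2 := (le_abs_self _).trans (hfle (x - s • y))
      rw [map_sub, map_smul, hfx, smul_eq_mul] at h2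
      have h3 : s * min ε δ ≤ s * ε := mul_le_mul_of_nonneg_left (min_le_left _ _) hs.1.le
      have h4 : s * d ≤ s * (f y + ε) := by linarith
      exact le_of_mul_le_mul_left h4 hs.1
  have ht : Tendsto (fun t : ℝ => x + t • y₀) (𝓝[>] 0) (𝓝 x) := by
    have : ContinuousAt (fun t : ℝ => x + t • y₀) 0 := by fun_prop
    have h := this.tendsto
    simp only [zero_smul, add_zero] at h
    exact h.mono_left nhdsWithin_le_nhds
  have hIoc : Set.Ioc 0 δ ∈ 𝓝[>] (0 : ℝ) := Ioc_mem_nhdsGT hδ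
  obtain ⟨t, htV, ht0, htδ⟩ := ((ht.eventually (hV.mem_nhds hxV)).and hIoc).exists
  have hev : ∀ᶠ y in 𝓝 (x + t • y₀), f y = ‖y‖ := by
    have hc : ContinuousAt (fun y : X => t⁻¹ • (y - x)) (x + t • y₀) := by fun_prop
    have hmem : O ∈ 𝓝 (t⁻¹ • (x + t • y₀ - x)) := by
      rw [add_sub_cancel_left, inv_smul_smul₀ ht0.ne']
      exact hO.mem_nhds hy₀
    filter_upwards [hc.eventually hmem] with y hy
    have := hfd _ hy t ⟨ht0.le, htδ⟩
    rwa [smul_inv_smul₀ ht0.ne', add_sub_cancel] at this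
  exact ⟨f, ⟨hfle, _, hev⟩, _, htV, hev⟩

/-- The face functionals of a separable polyhedral Banach space norm every vector. -/
lemma IsPolyhedral.exists_faceFunctional {X : Type*} [NormedAddCommGroup X] [NormedSpace ℝ X]
    [CompleteSpace X] [TopologicalSpace.SeparableSpace X] (hX : IsPolyhedral X) (x : X) :
    ∃ f ∈ faceFunctionals X, f x = ‖x‖ := by
  obtain ⟨δ, hδ, O, hO, ⟨y₀, hy₀⟩, hlin⟩ := hX.exists_isOpen_affine x
  have hV : IsOpen ((fun y : X => δ⁻¹ • (y - x)) ⁻¹' O) := hO.preimage (by fun_prop)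
  obtain ⟨f, hf, z, hz, hfz⟩ := hX.dense_locally_linear hV
    ⟨x + δ • y₀, by simpa [inv_smul_smul₀ hδ.ne'] using hy₀⟩
  refine ⟨f, hf, ?_⟩
  set y := δ⁻¹ • (z - x) with hy
  have hzy : z = x + δ • y := by rw [hy, smul_inv_smul₀ hδ.ne', add_sub_cancel]
  have ht : Tendsto (fun t : ℝ => x + t • y) (𝓝[<] δ) (𝓝 z) := by
    have : ContinuousAt (fun t : ℝ => x + t • y) δ := by fun_prop
    have h := this.tendsto
    rw [← hzy] at h
    exact h.mono_left nhdsWithin_le_nhds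
  have hIco : Set.Ico 0 δ ∈ 𝓝[<] δ := Ico_mem_nhdsLT hδ
  obtain ⟨t, h1, ht0, htδ⟩ := ((ht.eventually hfz).and hIco).exists
  have h2 := hfz.self_of_nhds
  rw [hzy] at h2
  rw [hlin y hz t ⟨ht0, htδ.le⟩, map_add, map_smul, smul_eq_mul] at h1
  rw [hlin y hz δ ⟨hδ.le, le_rfl⟩, map_add, map_smul, smul_eq_mul] at h2
  set d := (‖x + δ • y‖ - ‖x‖) / δ
  have h3 : (δ - t) * (f y - d) = 0 := by linarith
  rcases mul_eq_zero.1 h3 with h4 | h4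
  · linarith
  · have : f y = d := by linarith
    rw [this] at h1
    linarith

/-- The seminorm `x ↦ sup_{g ∈ S} |g x|` (meaningful when `S` is bounded). -/
noncomputable def supSeminorm {X : Type*} [NormedAddCommGroup X] [NormedSpace ℝ X]
    (S : Set (X →L[ℝ] ℝ)) : Seminorm ℝ X :=
  ⨆ g : S, (normSeminorm ℝ ℝ).comp (g.1 : X →ₗ[ℝ] ℝ)

section supSeminorm

variable {X : Type*} [NormedAddCommGroup X] [NormedSpace ℝ X]

lemma supSeminorm_apply {S : Set (X →L[ℝ] ℝ)} {p : X → ℝ} (hS : ∀ g ∈ S, ∀ x, |g x| ≤ p x)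
    (x : X) : supSeminorm S x = ⨆ g : S, |g.1 x| := by
  rw [supSeminorm, Seminorm.iSup_apply]
  · rfl
  · rw [Seminorm.bddAbove_range_iff]
    rintro y
    refine ⟨p y, ?_⟩
    rintro _ ⟨g, rfl⟩
    exact hS g.1 g.2 y

lemma abs_le_supSeminorm {S : Set (X →L[ℝ] ℝ)} {p : X → ℝ} (hS : ∀ g ∈ S, ∀ x, |g x| ≤ p x)
    {g : X →L[ℝ] ℝ} (hg : g ∈ S) (x : X) : |g x| ≤ supSeminorm S x := by
  rw [supSeminorm_apply hS]
  refine le_ciSup (f := fun g : S => |g.1 x|) ⟨p x, ?_⟩ ⟨g, hg⟩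
  rintro _ ⟨g, rfl⟩
  exact hS g.1 g.2 x

lemma supSeminorm_le {S : Set (X →L[ℝ] ℝ)} {p : X → ℝ} (hS : ∀ g ∈ S, ∀ x, |g x| ≤ p x)
    {x : X} {a : ℝ} (ha : 0 ≤ a) (h : ∀ g ∈ S, |g x| ≤ a) : supSeminorm S x ≤ a := by
  rw [supSeminorm_apply hS]
  exact Real.iSup_le (fun g => h g.1 g.2) ha

/-- A seminorm `q` is locally the maximum of the absolute values of finitely many functionals
from `H`, away from the origin. -/
def IsLocallyFiniteSup (q : Seminorm ℝ X) (H : Set (X →L[ℝ] ℝ)) : Prop :=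
  (∀ h ∈ H, ∀ y, |h y| ≤ q y) ∧
    ∀ x ≠ 0, ∃ F ⊆ H, F.Finite ∧ ∀ᶠ y in 𝓝 x, ∃ h ∈ F, |h y| = q y

/-- If the supremum of a set of functionals is reached within one of countably many totally
bounded pieces, then, after enlarging the norm by at most a factor of two, the supremum becomes
locally finite. -/
lemma exists_isLocallyFiniteSup (p : Seminorm ℝ X) {c C : ℝ} (hc : 0 < c)
    (hcp : ∀ x, c * ‖x‖ ≤ p x) (hpC : ∀ x, p x ≤ C * ‖x‖)
    (T : ℕ → Set (X →L[ℝ] ℝ)) (hT : ∀ n, TotallyBounded (T n))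
    (hTp : ∀ n, ∀ g ∈ T n, ∀ x, |g x| ≤ p x)
    (hpT : ∀ x ≠ 0, ∃ n, ∀ δ > 0, ∃ g ∈ T n, p x - δ < |g x|) :
    ∃ (q : Seminorm ℝ X) (H : Set (X →L[ℝ] ℝ)), H.Countable ∧ IsLocallyFiniteSup q H ∧
      ∀ x, p x ≤ q x ∧ q x ≤ 2 * p x := by
  let η : ℕ → ℝ := fun n => (1 / 2) ^ n
  have hη0 : ∀ n, 0 < η n := fun n => by positivity
  have hη1 : ∀ n, η n ≤ 1 := fun n => pow_le_one₀ (by norm_num) (by norm_num)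
  have hηanti : Antitone η := pow_right_anti₀ (by norm_num) (by norm_num)
  have hηlim : Tendsto η atTop (𝓝 0) :=
    tendsto_pow_atTop_nhds_zero_of_lt_one (by norm_num) (by norm_num)
  let ρ : ℕ → ℝ := fun n => c * η n / 8
  have hρ : ∀ n, 0 < ρ n := fun n => by have := hη0 n; positivity
  choose N hNT hNfin hNcov using fun n =>
    Metric.finite_approx_of_totallyBounded (hT n) (ρ n) (hρ n)
  let K : ℕ → Set (X →L[ℝ] ℝ) := fun n => (fun g => (1 + η n) • g) '' N n
  have hKfin : ∀ n, (K n).Finite := fun n => (hNfin n).image _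
  have hKle : ∀ n, ∀ h ∈ K n, ∀ y, |h y| ≤ (1 + η n) * p y := by
    rintro n _ ⟨g, hg, rfl⟩ y
    have h0 := hη0 n
    simp only [FunLike.coe_smul, Pi.smul_apply, smul_eq_mul, abs_mul]
    rw [abs_of_pos (by linarith : 0 < 1 + η n)]
    exact mul_le_mul_of_nonneg_left (hTp n g (hNT n hg) y) (by linarith)
  let H : Set (X →L[ℝ] ℝ) := ⋃ n, K n
  have hH2 : ∀ h ∈ H, ∀ y, |h y| ≤ 2 * p y := by
    intro h hh y
    obtain ⟨n, hn⟩ := Set.mem_iUnion.1 hh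
    refine (hKle n h hn y).trans (mul_le_mul_of_nonneg_right ?_ (apply_nonneg p y))
    linarith [hη1 n]
  have hbig : ∀ x ≠ 0, ∃ n, ∃ h ∈ K n, (1 + η n / 2) * p x < |h x| := by
    intro x hx
    have hxn : 0 < ‖x‖ := norm_pos_iff.2 hx
    have hpx : 0 < p x := (mul_pos hc hxn).trans_le (hcp x)
    obtain ⟨n, hn⟩ := hpT x hx
    have h0 := hη0 n
    have h1 := hη1 n
    obtain ⟨g, hg, hgx⟩ := hn (η n / 8 * p x) (by positivity)
    obtain ⟨d, hd, hgd⟩ := Set.mem_iUnion₂.1 (hNcov n hg)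
    refine ⟨n, _, ⟨d, hd, rfl⟩, ?_⟩
    have h2 : |g x - d x| ≤ η n / 8 * p x := by
      have h3 : |(g - d) x| ≤ ‖g - d‖ * ‖x‖ := (g - d).le_opNorm x
      have h4 : ‖g - d‖ ≤ ρ n := by
        rw [← dist_eq_norm]
        exact (Metric.mem_ball.1 hgd).le
      have h5 : ‖g - d‖ * ‖x‖ ≤ ρ n * ‖x‖ := mul_le_mul_of_nonneg_right h4 hxn.le
      have h6 : η n / 8 * (c * ‖x‖) ≤ η n / 8 * p x :=
        mul_le_mul_of_nonneg_left (hcp x) (by positivity)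
      have h7 : ρ n * ‖x‖ = η n / 8 * (c * ‖x‖) := by simp only [ρ]; ring
      exact h3.trans (by linarith)
    have h3 : |g x| ≤ |g x - d x| + |d x| := by
      simpa using abs_add_le (g x - d x) (d x)
    have h4 : (1 - η n / 4) * p x < |d x| := by linarith
    simp only [FunLike.coe_smul, Pi.smul_apply, smul_eq_mul, abs_mul]
    rw [abs_of_pos (by linarith : 0 < 1 + η n)]
    calc (1 + η n / 2) * p x ≤ (1 + η n) * ((1 - η n / 4) * p x) := by
          nlinarith [mul_nonneg h0.le hpx.le, mul_nonneg (mul_nonneg h0.le hpx.le) (sub_nonneg.2 h1)]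
      _ < (1 + η n) * |d x| := by gcongr
  have hKH : ∀ n, K n ⊆ H := fun n => Set.subset_iUnion K n
  refine ⟨supSeminorm H, H, Set.countable_iUnion fun n => (hKfin n).countable,
    ⟨fun h hh y => abs_le_supSeminorm hH2 hh y, fun x hx => ?_⟩, fun x => ⟨?_, ?_⟩⟩
  · obtain ⟨n, h, hh, hhx⟩ := hbig x hx
    have hxn : 0 < ‖x‖ := norm_pos_iff.2 hx
    have hpx : 0 < p x := (mul_pos hc hxn).trans_le (hcp x)
    obtain ⟨M, hM⟩ := ((hηlim.eventually_lt_const (half_pos (hη0 n))).and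
      (eventually_gt_atTop n)).exists
    have hpc : Continuous p :=
      Seminorm.continuous_of_le (q := C.toNNReal • normSeminorm ℝ X)
        (by
          change Continuous fun x : X => (C.toNNReal : ℝ) * ‖x‖
          fun_prop)
        (fun x => (hpC x).trans
          (mul_le_mul_of_nonneg_right (Real.le_coe_toNNReal C) (norm_nonneg x)))
    have hev : ∀ᶠ y in 𝓝 x, (1 + η M) * p y < |h y| := by
      have c1 : ContinuousAt (fun y => (1 + η M) * p y) x := by fun_prop
      have c2 : ContinuousAt (fun y => |h y|) x := by fun_prop
      refine c1.eventually_lt c2 (lt_of_le_of_lt ?_ hhx)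
      exact mul_le_mul_of_nonneg_right (by linarith [hM.1]) hpx.le
    refine ⟨⋃ m ∈ Set.Iio M, K m, Set.iUnion₂_subset fun m _ => hKH m,
      (Set.finite_Iio M).biUnion fun m _ => hKfin m, ?_⟩
    filter_upwards [hev] with y hy
    have hmem : h ∈ ⋃ m ∈ Set.Iio M, K m := Set.mem_biUnion hM.2 hh
    obtain ⟨k, hk, hmax⟩ := Set.exists_max_image (⋃ m ∈ Set.Iio M, K m) (fun h => |h y|)
      ((Set.finite_Iio M).biUnion fun m _ => hKfin m) ⟨h, hmem⟩
    have hkH : k ∈ H := Set.iUnion₂_subset (fun m _ => hKH m) hk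
    refine ⟨k, hk, le_antisymm (abs_le_supSeminorm hH2 hkH y)
      (supSeminorm_le hH2 (abs_nonneg _) fun g hg => ?_)⟩
    obtain ⟨m, hm⟩ := Set.mem_iUnion.1 hg
    rcases lt_or_ge m M with hmM | hmM
    · exact hmax g (Set.mem_biUnion hmM hm)
    · refine ((hKle m g hm y).trans ?_).trans (hmax h hmem)
      refine le_trans (mul_le_mul_of_nonneg_right ?_ (apply_nonneg p y)) hy.le
      linarith [hηanti hmM]
  · rcases eq_or_ne x 0 with rfl | hx
    · simp
    · obtain ⟨n, h, hh, hhx⟩ := hbig x hx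
      refine le_trans ?_ (hhx.le.trans (abs_le_supSeminorm hH2 (hKH n hh) x))
      nlinarith [apply_nonneg p x, hη0 n]
  · exact supSeminorm_le hH2 (by have := apply_nonneg p x; positivity) fun g hg => hH2 g hg x

/-- On a finite-dimensional subspace, a locally finite supremum of functionals is a maximum of
finitely many of them. -/
lemma IsLocallyFiniteSup.exists_finite {q : Seminorm ℝ X} {H : Set (X →L[ℝ] ℝ)}
    (hq : IsLocallyFiniteSup q H) (Z : Submodule ℝ X) [FiniteDimensional ℝ Z] :
    ∃ F ⊆ H, F.Finite ∧ ∀ z ∈ Z, z ≠ 0 → ∃ h ∈ F, |h z| = q z := by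
  have : ProperSpace Z := FiniteDimensional.proper ℝ Z
  have hcomp : IsCompact ((↑) '' Metric.sphere (0 : Z) 1 : Set X) :=
    (isCompact_sphere (0 : Z) 1).image continuous_subtype_val
  obtain ⟨F, hFH, hF, hmax⟩ : ∃ F ⊆ H, F.Finite ∧
      ∀ z ∈ ((↑) '' Metric.sphere (0 : Z) 1 : Set X), ∃ h ∈ F, |h z| = q z := by
    refine hcomp.induction_on (p := fun s => ∃ F ⊆ H, F.Finite ∧ ∀ z ∈ s, ∃ h ∈ F, |h z| = q z)
      ⟨∅, by simp⟩ ?_ ?_ ?_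
    · rintro s t hst ⟨F, h1, h2, h3⟩
      exact ⟨F, h1, h2, fun z hz => h3 z (hst hz)⟩
    · rintro s t ⟨F, h1, h2, h3⟩ ⟨G, k1, k2, k3⟩
      refine ⟨F ∪ G, Set.union_subset h1 k1, h2.union k2, ?_⟩
      rintro z (hz | hz)
      · obtain ⟨h, hh, e⟩ := h3 z hz
        exact ⟨h, Or.inl hh, e⟩
      · obtain ⟨h, hh, e⟩ := k3 z hz
        exact ⟨h, Or.inr hh, e⟩
    · rintro _ ⟨z, hz, rfl⟩
      have hz0 : (z : X) ≠ 0 := by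
        intro h
        have : ‖z‖ = 1 := by simpa using hz
        rw [show ‖z‖ = ‖(z : X)‖ from rfl, h, norm_zero] at this
        exact zero_ne_one this
      obtain ⟨F, h1, h2, h3⟩ := hq.2 z hz0
      exact ⟨_, mem_nhdsWithin_of_mem_nhds h3, F, h1, h2, fun y hy => hy⟩
  refine ⟨F, hFH, hF, fun z hz hz0 => ?_⟩
  have hn : 0 < ‖z‖ := norm_pos_iff.2 hz0
  obtain ⟨h, hh, e⟩ := hmax (‖z‖⁻¹ • z) ⟨‖z‖⁻¹ • ⟨z, hz⟩, by
    simp [norm_smul, hn.ne'], rfl⟩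
  refine ⟨h, hh, ?_⟩
  rw [map_smul, map_smul_eq_mul, smul_eq_mul, abs_mul, Real.norm_eq_abs] at e
  exact mul_left_cancel₀ (abs_pos.2 (inv_pos.2 hn).ne').ne' e

end supSeminorm

/-- A separable isomorphically polyhedral Banach space has an equivalent norm that is a locally
finite supremum of countably many functionals. -/
lemma IsIsomorphicallyPolyhedral.exists_isLocallyFiniteSup {X : Type*} [NormedAddCommGroup X]
    [NormedSpace ℝ X] [CompleteSpace X] [TopologicalSpace.SeparableSpace X]
    (hX : IsIsomorphicallyPolyhedral X) :
    ∃ (q : Seminorm ℝ X) (H : Set (X →L[ℝ] ℝ)) (c C : ℝ), H.Countable ∧ IsLocallyFiniteSup q H ∧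
      0 < c ∧ (∀ x, c * ‖x‖ ≤ q x) ∧ ∀ x, q x ≤ C * ‖x‖ := by
  obtain ⟨Z, _, _, hZ, ⟨T⟩⟩ := hX
  have : CompleteSpace Z :=
    (completeSpace_congr (e := T.toLinearEquiv.toEquiv) T.isUniformEmbedding).1 inferInstance
  have : TopologicalSpace.SeparableSpace Z :=
    T.surjective.denseRange.separableSpace T.continuous
  obtain ⟨f₀, hf₀, -⟩ := hZ.exists_faceFunctional 0
  obtain ⟨f, hf⟩ := (countable_faceFunctionals Z).exists_eq_range ⟨f₀, hf₀⟩
  have hfmem : ∀ n, f n ∈ faceFunctionals Z := fun n => hf ▸ Set.mem_range_self n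
  let p : Seminorm ℝ X := (normSeminorm ℝ Z).comp (T : X →ₗ[ℝ] Z)
  have hp : ∀ x, p x = ‖T x‖ := fun x => rfl
  set K := ‖(T.symm : Z →L[ℝ] X)‖ + 1
  have hK : 0 < K := by positivity
  have hlow : ∀ x, K⁻¹ * ‖x‖ ≤ p x := by
    intro x
    rw [hp, inv_mul_le_iff₀ hK]
    have := (T.symm : Z →L[ℝ] X).le_opNorm (T x)
    simp only [ContinuousLinearEquiv.coe_coe, ContinuousLinearEquiv.symm_apply_apply] at this
    nlinarith [norm_nonneg (T x)]
  have hup : ∀ x, p x ≤ ‖(T : X →L[ℝ] Z)‖ * ‖x‖ := fun x => (T : X →L[ℝ] Z).le_opNorm x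
  obtain ⟨q, H, hH, hq, hpq⟩ := _root_.exists_isLocallyFiniteSup p (inv_pos.2 hK) hlow hup
    (fun n => {(f n).comp (T : X →L[ℝ] Z)}) (fun n => (Set.finite_singleton _).totallyBounded)
    (by
      rintro n _ rfl x
      exact (hfmem n).1 (T x))
    (by
      intro x _
      obtain ⟨g, hg, hgx⟩ := hZ.exists_faceFunctional (T x)
      rw [hf] at hg
      obtain ⟨n, rfl⟩ := hg
      refine ⟨n, fun δ hδ => ⟨_, rfl, ?_⟩⟩
      change p x - δ < |f n (T x)|
      rw [hgx, hp, abs_norm]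
      linarith)
  refine ⟨q, H, K⁻¹, 2 * ‖(T : X →L[ℝ] Z)‖, hH, hq, inv_pos.2 hK,
    fun x => (hlow x).trans (hpq x).1, fun x => (hpq x).2.trans ?_⟩
  linarith [hup x]

section density

variable {X : Type*} [NormedAddCommGroup X] [NormedSpace ℝ X]

/-- An instance of the variational principle: on a nonempty closed bounded set, a functional is,
up to a small multiple of the distance, maximal at some point. -/
lemma exists_le_add_mul_norm_sub [CompleteSpace X] (f : X →L[ℝ] ℝ) {K : Set X} (hK : IsClosed K)
    (hne : K.Nonempty) (hb : BddAbove (f '' K)) {ε : ℝ} (hε : 0 < ε) :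
    ∃ v ∈ K, ∀ y ∈ K, f y ≤ f v + ε * ‖y - v‖ := by
  let S : X → Set X := fun x => {y | y ∈ K ∧ f x + ε * ‖y - x‖ ≤ f y}
  have hSK : ∀ x, S x ⊆ K := fun x y hy => hy.1
  have hself : ∀ x ∈ K, x ∈ S x := fun x hx => ⟨hx, by simp⟩
  have hstep : ∀ x : K, ∃ z : K, z.1 ∈ S x ∧ ∀ y ∈ S x, f y - f z ≤ f z - f x := by
    rintro ⟨x, hx⟩
    have hbS : BddAbove (f '' S x) := hb.mono (Set.image_mono (hSK x))
    set s := sSup (f '' S x)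
    have hle : ∀ y ∈ S x, f y ≤ s := fun y hy => le_csSup hbS ⟨y, hy, rfl⟩
    rcases (hle x (hself x hx)).eq_or_lt with h | h
    · refine ⟨⟨x, hx⟩, hself x hx, fun y hy => ?_⟩
      have := hle y hy
      simp only
      linarith
    · obtain ⟨_, ⟨z, hz, rfl⟩, hlt⟩ := exists_lt_of_lt_csSup
        (⟨_, x, hself x hx, rfl⟩ : (f '' S x).Nonempty) (show (f x + s) / 2 < s by linarith)
      refine ⟨⟨z, hz.1⟩, hz, fun y hy => ?_⟩
      have := hle y hy
      simp only
      linarith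
  choose nx hnx1 hnx2 using hstep
  obtain ⟨x₀, hx₀⟩ := hne
  let u : ℕ → K := fun n => nx^[n] ⟨x₀, hx₀⟩
  have hu : ∀ n, u (n + 1) = nx (u n) := fun n => Function.iterate_succ_apply' nx n _
  have hu1 : ∀ n, f (u n) + ε * ‖(u (n + 1) : X) - u n‖ ≤ f (u (n + 1)) := fun n => by
    rw [hu]
    exact (hnx1 (u n)).2
  have hmono : Monotone fun n => f (u n) := monotone_nat_of_le_succ fun n => by
    have := hu1 n
    have := mul_nonneg hε.le (norm_nonneg ((u (n + 1) : X) - u n))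
    linarith
  have hdist : ∀ n k, f (u n) + ε * ‖(u (n + k) : X) - u n‖ ≤ f (u (n + k)) := by
    intro n k
    induction k with
    | zero => simp
    | succ k ih =>
      have h1 := hu1 (n + k)
      have h2 : ‖(u (n + k + 1) : X) - u n‖ ≤
          ‖(u (n + k + 1) : X) - u (n + k)‖ + ‖(u (n + k) : X) - u n‖ := by
        simpa using norm_add_le ((u (n + k + 1) : X) - u (n + k)) ((u (n + k) : X) - u n)
      have h3 := mul_le_mul_of_nonneg_left h2 hε.le
      rw [← add_assoc]
      linarith
  have hbd : BddAbove (Set.range fun n => f (u n)) := by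
    refine hb.mono ?_
    rintro _ ⟨n, rfl⟩
    exact ⟨u n, (u n).2, rfl⟩
  have hlim := tendsto_atTop_ciSup hmono hbd
  set L := ⨆ n, f (u n)
  have hL : ∀ n, f (u n) ≤ L := fun n => le_ciSup hbd n
  have hcau : CauchySeq fun n => (u n : X) := by
    refine cauchySeq_of_le_tendsto_0' (fun n => (L - f (u n)) / ε) (fun n m hnm => ?_) ?_
    · obtain ⟨k, rfl⟩ := Nat.exists_eq_add_of_le hnm
      rw [dist_comm, dist_eq_norm, le_div_iff₀ hε]
      have := hdist n k
      have := hL (n + k)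
      linarith
    · simpa using ((tendsto_const_nhds (x := L)).sub hlim).div_const ε
  obtain ⟨v, hv⟩ := cauchySeq_tendsto_of_complete hcau
  have hvK : v ∈ K := hK.mem_of_tendsto hv (Eventually.of_forall fun n => (u n).2)
  have hfv : f v = L := tendsto_nhds_unique ((f.continuous.tendsto v).comp hv) hlim
  have hnv : ∀ n, f (u n) + ε * ‖v - u n‖ ≤ f v := by
    intro n
    have h1 : Tendsto (fun m => f (u n) + ε * ‖(u m : X) - u n‖) atTop
        (𝓝 (f (u n) + ε * ‖v - u n‖)) :=
      tendsto_const_nhds.add ((hv.sub_const _).norm.const_mul ε)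
    refine le_of_tendsto h1 ?_
    filter_upwards [eventually_ge_atTop n] with m hm
    obtain ⟨k, rfl⟩ := Nat.exists_eq_add_of_le hm
    exact (hdist n k).trans (hfv ▸ hL _)
  refine ⟨v, hvK, fun y hy => ?_⟩
  by_contra! hlt
  have hyS : ∀ n, y ∈ S (u n) := by
    intro n
    refine ⟨hy, ?_⟩
    have h2 : ‖y - u n‖ ≤ ‖y - v‖ + ‖v - u n‖ := by
      simpa using norm_add_le (y - v) (v - u n)
    have h3 := mul_le_mul_of_nonneg_left h2 hε.le
    have := hnv n
    linarith
  have hle : f y - L ≤ L - L := by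
    refine le_of_tendsto_of_tendsto' (tendsto_const_nhds.sub ((tendsto_add_atTop_iff_nat 1).2 hlim))
      (((tendsto_add_atTop_iff_nat 1).2 hlim).sub hlim) fun n => ?_
    have := hnx2 (u n) y (hyS n)
    rwa [← hu] at this
  have := mul_nonneg hε.le (norm_nonneg (y - v))
  linarith

/-- Functionals realising an equivalent norm as a locally finite supremum span a dense subspace
of the dual. -/
lemma IsLocallyFiniteSup.exists_mem_span [CompleteSpace X] {q : Seminorm ℝ X}
    {H : Set (X →L[ℝ] ℝ)} (hq : IsLocallyFiniteSup q H) {c C : ℝ} (hc : 0 < c)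
    (hcq : ∀ x, c * ‖x‖ ≤ q x) (hqC : ∀ x, q x ≤ C * ‖x‖) (f : X →L[ℝ] ℝ) {ε : ℝ} (hε : 0 < ε) :
    ∃ e ∈ Submodule.span ℝ H, ‖f - e‖ ≤ ε := by
  have hcont : Continuous q :=
    Seminorm.continuous_of_le (q := C.toNNReal • normSeminorm ℝ X)
      (by
        change Continuous fun x : X => (C.toNNReal : ℝ) * ‖x‖
        fun_prop)
      (fun x => (hqC x).trans
        (mul_le_mul_of_nonneg_right (Real.le_coe_toNNReal C) (norm_nonneg x)))
  obtain ⟨v, hv, hmax⟩ := exists_le_add_mul_norm_sub f (K := {x | q x ≤ 1})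
    (isClosed_le hcont continuous_const) ⟨0, by simp⟩
    ⟨‖f‖ * c⁻¹, by
      rintro _ ⟨x, hx, rfl⟩
      refine (le_abs_self _).trans ((f.le_opNorm x).trans ?_)
      refine mul_le_mul_of_nonneg_left ?_ (norm_nonneg f)
      rw [← one_div, le_div_iff₀ hc, mul_comm]
      exact (hcq x).trans hx⟩ hε
  have habs : ∀ w : X, (∀ᶠ s in 𝓝[>] (0 : ℝ), q (v + s • w) ≤ 1) → f w ≤ ε * ‖w‖ := by
    intro w hw
    obtain ⟨s, hs, hs0⟩ := (hw.and self_mem_nhdsWithin).exists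
    have hs0 : 0 < s := hs0
    have h1 := hmax (v + s • w) hs
    rw [map_add, map_smul, add_sub_cancel_left, norm_smul, Real.norm_eq_abs, abs_of_pos hs0,
      smul_eq_mul] at h1
    refine le_of_mul_le_mul_left ?_ hs0
    linarith
  have hcv : ∀ w : X, Tendsto (fun s : ℝ => v + s • w) (𝓝[>] 0) (𝓝 v) := by
    intro w
    have : ContinuousAt (fun s : ℝ => v + s • w) 0 := by fun_prop
    have h := this.tendsto
    simp only [zero_smul, add_zero] at h
    exact h.mono_left nhdsWithin_le_nhds
  rcases eq_or_ne v 0 with rfl | hv0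
  · refine ⟨0, Submodule.zero_mem _, ?_⟩
    rw [sub_zero]
    have hle : ∀ w, f w ≤ ε * ‖w‖ := by
      refine fun w => habs w ?_
      have h1 := (hcont.tendsto 0).comp (hcv w)
      rw [map_zero] at h1
      exact (h1.eventually_lt_const one_pos).mono fun s hs => le_of_lt hs
    refine f.opNorm_le_bound hε.le fun w => abs_le.2 ⟨?_, hle w⟩
    have := hle (-w)
    rw [map_neg, norm_neg] at this
    linarith
  · obtain ⟨F, hFH, hF, hev⟩ := hq.2 v hv0
    have := hF.to_subtype
    let N : Submodule ℝ X := ⨅ h : F, LinearMap.ker (h.1 : X →ₗ[ℝ] ℝ)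
    have hN : ∀ w ∈ N, f w ≤ ε * ‖w‖ := by
      intro w hw
      refine habs w ?_
      filter_upwards [(hcv w).eventually hev] with s hs
      obtain ⟨h, hh, e⟩ := hs
      have hw0 : h w = 0 := (Submodule.mem_iInf _).1 hw ⟨h, hh⟩
      rw [← e, map_add, map_smul, hw0, smul_zero, add_zero]
      exact (hq.1 h (hFH hh) v).trans hv
    obtain ⟨g, hgf, hgn⟩ := exists_extension_norm_eq N (f.comp N.subtypeL)
    have hle : ‖g‖ ≤ ε := by
      rw [hgn]
      refine ContinuousLinearMap.opNorm_le_bound _ hε.le fun w => abs_le.2 ⟨?_, hN w w.2⟩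
      have := hN (-w) (neg_mem w.2)
      rw [map_neg, norm_neg] at this
      change _ ≤ f w
      change -(ε * ‖(w : X)‖) ≤ f w
      linarith
    have hspan : ((f - g : X →L[ℝ] ℝ) : X →ₗ[ℝ] ℝ) ∈
        Submodule.span ℝ (Set.range fun h : F => (h.1 : X →ₗ[ℝ] ℝ)) := by
      refine mem_span_of_iInf_ker_le_ker fun w hw => ?_
      have := hgf ⟨w, hw⟩
      change f w - g w = 0
      rw [this]
      simp
    have hmap : Set.range (fun h : F => (h.1 : X →ₗ[ℝ] ℝ)) =
        ContinuousLinearMap.coeLM ℝ '' F := by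
      rw [Set.image_eq_range]
      rfl
    rw [hmap, Submodule.span_image] at hspan
    obtain ⟨e, he, hee⟩ := hspan
    refine ⟨e, Submodule.span_mono hFH he, ?_⟩
    have : e = f - g := ContinuousLinearMap.coe_injective hee
    rw [this, sub_sub_cancel]
    exact hle

/-- A functional dominated by a multiple of a locally finite supremum can be replaced, without
changing it on a given finite-dimensional subspace, by a combination of finitely many of the
functionals defining the supremum. -/
lemma exists_mem_span_eqOn {q : Seminorm ℝ X} {F : Set (X →L[ℝ] ℝ)} (hF : F.Finite)
    (hFq : ∀ h ∈ F, ∀ y, |h y| ≤ q y) (Z : Submodule ℝ X)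
    (hZ : ∀ z ∈ Z, z ≠ 0 → ∃ h ∈ F, |h z| = q z) (hpos : ∀ z ≠ 0, 0 < q z)
    (r : X →L[ℝ] ℝ) {ε : ℝ} (hε : 0 ≤ ε) (hr : ∀ y, |r y| ≤ ε * q y) :
    ∃ r' ∈ Submodule.span ℝ F, (∀ z ∈ Z, r' z = r z) ∧ ∀ y, |r' y| ≤ ε * q y := by
  classical
  have := hF.fintype
  let A : X →ₗ[ℝ] (F → ℝ) := LinearMap.pi fun h => (h.1 : X →ₗ[ℝ] ℝ)
  have hA : ∀ x h, A x h = h.1 x := fun _ _ => rfl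
  have hAle : ∀ x, ‖A x‖ ≤ q x := fun x =>
    (pi_norm_le_iff_of_nonneg (apply_nonneg q x)).2 fun h => hFq h.1 h.2 x
  have hAge : ∀ z ∈ Z, q z ≤ ‖A z‖ := by
    intro z hz
    rcases eq_or_ne z 0 with rfl | h0
    · simp
    · obtain ⟨h, hh, e⟩ := hZ z hz h0
      rw [← e]
      exact norm_le_pi_norm (A z) ⟨h, hh⟩
  let B : Z →ₗ[ℝ] (F → ℝ) := A.comp Z.subtype
  have hB : Function.Injective B := by
    refine (injective_iff_map_eq_zero B).2 fun z hz => ?_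
    by_contra h0
    have h1 := hAge z z.2
    rw [show A z = 0 from hz, norm_zero] at h1
    exact absurd h1 (not_le.2 (hpos z fun h => h0 (Subtype.ext h)))
  let E := LinearEquiv.ofInjective B hB
  let φ : (F → ℝ) →ₗ.[ℝ] ℝ :=
    ⟨LinearMap.range B, ((r : X →ₗ[ℝ] ℝ).comp Z.subtype).comp E.symm.toLinearMap⟩
  obtain ⟨ψ, hψ1, hψ2⟩ := exists_extension_of_le_sublinear φ (fun v => ε * ‖v‖)
    (fun c hc x => by rw [norm_smul, Real.norm_eq_abs, abs_of_pos hc]; ring)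
    (fun x y => by
      rw [← mul_add]
      exact mul_le_mul_of_nonneg_left (norm_add_le x y) hε)
    (fun w => by
      obtain ⟨z, rfl⟩ := E.surjective w
      change r (E.symm (E z)) ≤ ε * ‖A z‖
      rw [E.symm_apply_apply]
      exact (le_abs_self _).trans ((hr z).trans (mul_le_mul_of_nonneg_left (hAge z z.2) hε)))
  let r' : X →L[ℝ] ℝ := ∑ h : F, ψ (Pi.single h 1) • h.1
  have hr' : ∀ x, r' x = ψ (A x) := by
    intro x
    conv_rhs => rw [← Finset.univ_sum_single (A x), map_sum]
    simp only [r', sum_apply]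
    refine Finset.sum_congr rfl fun h _ => ?_
    rw [FunLike.coe_smul, Pi.smul_apply, smul_eq_mul, mul_comm, ← smul_eq_mul, ← map_smul,
      ← Pi.single_smul, smul_eq_mul, mul_one]
    rfl
  refine ⟨r', Submodule.sum_mem _ fun h _ =>
    Submodule.smul_mem _ _ (Submodule.subset_span h.2), fun z hz => ?_, fun y => ?_⟩
  · rw [hr']
    have := hψ1 (E ⟨z, hz⟩)
    refine Eq.trans (show ψ (A z) = φ (E ⟨z, hz⟩) from this) ?_
    change r (E.symm (E ⟨z, hz⟩)) = r z
    rw [E.symm_apply_apply]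
  · rw [hr']
    have h1 : ε * ‖A y‖ ≤ ε * q y := mul_le_mul_of_nonneg_left (hAle y) hε
    refine abs_le.2 ⟨?_, (hψ2 _).trans h1⟩
    have := hψ2 (-(A y))
    rw [map_neg, norm_neg] at this
    linarith

end density

lemma totallyBounded_inter_of_finiteDimensional {V : Type*} [NormedAddCommGroup V]
    [NormedSpace ℝ V] {S : Set V} (hS : Bornology.IsBounded S) (E : Submodule ℝ V)
    [FiniteDimensional ℝ E] : TotallyBounded (S ∩ E) := by
  have : ProperSpace E := FiniteDimensional.proper ℝ E
  have hb : Bornology.IsBounded ((↑) ⁻¹' S : Set E) := by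
    obtain ⟨R, hR⟩ := hS.exists_norm_le
    exact isBounded_iff_forall_norm_le.2 ⟨R, fun x hx => hR x hx⟩
  have := (hb.isCompact_closure.totallyBounded.subset subset_closure).image
    (uniformContinuous_subtype_val (α := V) (p := (· ∈ E)))
  refine this.subset ?_
  rintro x ⟨hxS, hxE⟩
  exact ⟨⟨x, hxE⟩, hxS, rfl⟩

lemma exists_subset_image_Iio {α : Type*} {h : ℕ → α} {F : Set α} (hF : F.Finite)
    (hFh : F ⊆ Set.range h) : ∃ n, F ⊆ h '' Set.Iio n := by
  obtain ⟨n, hn⟩ := (hF.image fun g => Function.invFun h g).bddAbove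
  exact ⟨n + 1, fun g hg => ⟨Function.invFun h g, Nat.lt_succ_of_le (hn ⟨g, hg, rfl⟩),
    Function.invFun_eq (hFh hg)⟩⟩

/-- A separable Banach space with an equivalent norm that is a locally finite supremum has such
a norm with universal equivalence constants. -/
lemma IsLocallyFiniteSup.exists_uniform {X : Type*} [NormedAddCommGroup X] [NormedSpace ℝ X]
    [CompleteSpace X] [TopologicalSpace.SeparableSpace X] {q : Seminorm ℝ X}
    {H : Set (X →L[ℝ] ℝ)} (hH : H.Countable) (hq : IsLocallyFiniteSup q H) {c C : ℝ} (hc : 0 < c)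
    (hcq : ∀ x, c * ‖x‖ ≤ q x) (hqC : ∀ x, q x ≤ C * ‖x‖) :
    ∃ (p : Seminorm ℝ X) (K : Set (X →L[ℝ] ℝ)), IsLocallyFiniteSup p K ∧
      ∀ x, ‖x‖ ≤ p x ∧ p x ≤ 4 * ‖x‖ := by
  obtain ⟨h, hh⟩ := (hH.insert 0).exists_eq_range (Set.insert_nonempty 0 H)
  have hHh : H ⊆ Set.range h := hh ▸ Set.subset_insert 0 H
  let u := TopologicalSpace.denseSeq X
  let ε : ℝ := 1 / (2 * (|C| + 1))
  have hC0 := abs_nonneg C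
  have hε : 0 < ε := by positivity
  have hεq : ∀ y, 2 * (ε * q y) ≤ ‖y‖ := by
    intro y
    have h1 : q y ≤ (|C| + 1) * ‖y‖ := (hqC y).trans
      (mul_le_mul_of_nonneg_right (by linarith [le_abs_self C]) (norm_nonneg y))
    calc 2 * (ε * q y) ≤ 2 * (ε * ((|C| + 1) * ‖y‖)) := by gcongr
      _ = ‖y‖ := by simp only [ε]; field_simp
  have hpos : ∀ z ≠ 0, 0 < q z := fun z hz =>
    (mul_pos hc (norm_pos_iff.2 hz)).trans_le (hcq z)
  let E : ℕ → Submodule ℝ (X →L[ℝ] ℝ) := fun n => Submodule.span ℝ (h '' Set.Iio n)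
  have hEmono : Monotone E := fun m n hmn =>
    Submodule.span_mono (Set.image_mono (Set.Iio_subset_Iio hmn))
  have hEfin : ∀ n, FiniteDimensional ℝ (E n) := fun n =>
    FiniteDimensional.span_of_finite ℝ ((Set.finite_Iio n).image h)
  have hEspan : ∀ e ∈ Submodule.span ℝ H, ∃ n, e ∈ E n := by
    intro e he
    obtain ⟨t, ht, het⟩ := Submodule.mem_span_finite_of_mem_span he
    obtain ⟨n, hn⟩ := exists_subset_image_Iio t.finite_toSet (ht.trans hHh)
    exact ⟨n, Submodule.span_mono hn het⟩
  let D : ℕ → Set (X →L[ℝ] ℝ) := fun n => {g | ∃ f : X →L[ℝ] ℝ, (∀ y, |f y| ≤ ‖y‖) ∧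
    ∃ e ∈ E n, (∀ y, |f y - e y| ≤ ε * q y) ∧ (∀ y, |g y - e y| ≤ ε * q y) ∧
      ∀ j < n, |g (u j) - f (u j)| ≤ 1 / ((n : ℝ) + 1)}
  let S : Set (X →L[ℝ] ℝ) := ⋃ n, D n
  have hDS : ∀ n, D n ⊆ S := fun n => Set.subset_iUnion D n
  have hS : ∀ g ∈ S, ∀ y, |g y| ≤ 2 * ‖y‖ := by
    intro g hg y
    obtain ⟨n, f, hf, e, -, hfe, hge, -⟩ := Set.mem_iUnion.1 hg
    have h1 := abs_le.1 (hf y)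
    have h2 := abs_le.1 (hfe y)
    have h3 := abs_le.1 (hge y)
    have h4 := hεq y
    exact abs_le.2 ⟨by linarith, by linarith⟩
  have hexists : ∀ x ≠ 0, ∃ n, ∃ g ∈ D n, ‖x‖ < |g x| := by
    intro x hx
    obtain ⟨f, hf1, hfx⟩ := exists_dual_vector'' ℝ x
    have hfx : f x = ‖x‖ := hfx
    have hfle : ∀ y, |f y| ≤ ‖y‖ := fun y => by simpa using f.le_of_opNorm_le hf1 y
    obtain ⟨e, he, hfe⟩ := hq.exists_mem_span hc hcq hqC f (show 0 < c * ε / 2 by positivity)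
    obtain ⟨n, hn⟩ := hEspan e he
    have hfe' : ∀ y, |f y - e y| ≤ ε / 2 * q y := by
      intro y
      have h1 : |(f - e) y| ≤ ‖f - e‖ * ‖y‖ := (f - e).le_opNorm y
      have h2 := mul_le_mul_of_nonneg_right hfe (norm_nonneg y)
      have h3 := mul_le_mul_of_nonneg_left (hcq y) (half_pos hε).le
      exact h1.trans (by linarith)
    set M := ∑ j ∈ Finset.range n, ‖u j‖ + 1
    have hM : 0 < M := by positivity
    set δ := min (c * ε / 2) (1 / (((n : ℝ) + 1) * M))
    have hδ : 0 < δ := lt_min (by positivity) (by positivity)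
    refine ⟨n, (1 + δ) • f, ⟨f, hfle, e, hn, fun y => (hfe' y).trans ?_, fun y => ?_,
      fun j hj => ?_⟩, ?_⟩
    · nlinarith [apply_nonneg q y]
    · have h1 := abs_le.1 (hfe' y)
      have h2 : |δ * f y| ≤ ε / 2 * q y := by
        rw [abs_mul, abs_of_pos hδ]
        calc δ * |f y| ≤ c * ε / 2 * ‖y‖ := by
              gcongr
              · exact min_le_left _ _
              · exact hfle y
          _ = ε / 2 * (c * ‖y‖) := by ring
          _ ≤ ε / 2 * q y := by gcongr; exact hcq y
      have h3 := abs_le.1 h2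
      simp only [FunLike.coe_smul, Pi.smul_apply, smul_eq_mul]
      exact abs_le.2 ⟨by linarith, by linarith⟩
    · simp only [FunLike.coe_smul, Pi.smul_apply, smul_eq_mul]
      rw [show (1 + δ) * f (u j) - f (u j) = δ * f (u j) by ring, abs_mul, abs_of_pos hδ]
      have h1 : ‖u j‖ ≤ M := by
        have := Finset.single_le_sum (f := fun j => ‖u j‖) (fun i _ => norm_nonneg _)
          (Finset.mem_range.2 hj)
        linarith
      calc δ * |f (u j)| ≤ 1 / (((n : ℝ) + 1) * M) * M := by
            gcongr
            · exact min_le_right _ _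
            · exact (hfle _).trans h1
        _ = 1 / ((n : ℝ) + 1) := by field_simp
    · have : 0 < ‖x‖ := norm_pos_iff.2 hx
      simp only [FunLike.coe_smul, Pi.smul_apply, smul_eq_mul]
      rw [hfx, abs_of_pos (by positivity)]
      nlinarith
  have htail : ∀ x a, ‖x‖ < a → ∃ N, ∀ n ≥ N, ∀ g ∈ D n, |g x| ≤ a := by
    intro x a hxa
    have hη : 0 < (a - ‖x‖) / 2 := by linarith
    obtain ⟨j, hj⟩ := (TopologicalSpace.denseRange_denseSeq X).exists_dist_lt x hη
    obtain ⟨k, hk⟩ := exists_nat_one_div_lt hη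
    refine ⟨max (j + 1) k, fun n hn g hg => ?_⟩
    obtain ⟨f, hf, e, -, hfe, hge, hgf⟩ := hg
    have h1 := abs_le.1 (hf x)
    have h2 := abs_le.1 (hgf j (by omega))
    have h3 := abs_le.1 (hfe (x - u j))
    have h4 := abs_le.1 (hge (x - u j))
    have h5 := hεq (x - u j)
    have h6 : ‖x - u j‖ < (a - ‖x‖) / 2 := by rwa [← dist_eq_norm]
    have h7 : 1 / ((n : ℝ) + 1) ≤ 1 / ((k : ℝ) + 1) :=
      Nat.one_div_le_one_div ((le_max_right _ _).trans hn)
    simp only [map_sub] at h3 h4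
    exact abs_le.2 ⟨by linarith, by linarith⟩
  have hreplace : ∀ x n, ∃ m, ∀ g ∈ D n, ∃ g' ∈ D n, g' ∈ E m ∧ g' x = g x := by
    intro x n
    let Z := Submodule.span ℝ (insert x (u '' Set.Iio n))
    have : FiniteDimensional ℝ Z :=
      FiniteDimensional.span_of_finite ℝ (((Set.finite_Iio n).image u).insert x)
    obtain ⟨F, hFH, hF, hFZ⟩ := hq.exists_finite Z
    obtain ⟨k, hk⟩ := exists_subset_image_Iio hF (hFH.trans hHh)
    refine ⟨max n k, ?_⟩
    rintro g ⟨f, hf, e, he, hfe, hge, hgf⟩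
    obtain ⟨r, hr, hrZ, hrq⟩ := exists_mem_span_eqOn hF (fun g hg => hq.1 g (hFH hg)) Z hFZ hpos
      (g - e) hε.le hge
    have hZ : ∀ z ∈ Z, (e + r) z = g z := fun z hz => by
      have := hrZ z hz
      simp [this]
    refine ⟨e + r, ⟨f, hf, e, he, hfe, fun y => ?_, fun j hj => ?_⟩, ?_, ?_⟩
    · simpa using hrq y
    · rw [hZ _ (Submodule.subset_span (Or.inr ⟨j, hj, rfl⟩))]
      exact hgf j hj
    · exact add_mem (hEmono (le_max_left n k) he)
        (hEmono (le_max_right n k) (Submodule.span_mono hk hr))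
    · exact hZ x (Submodule.subset_span (Or.inl rfl))
  have hlow : ∀ x, ‖x‖ ≤ supSeminorm S x := by
    intro x
    rcases eq_or_ne x 0 with rfl | hx
    · simp
    · obtain ⟨n, g, hg, hgx⟩ := hexists x hx
      exact hgx.le.trans (abs_le_supSeminorm hS (hDS n hg) x)
  have hup : ∀ x, supSeminorm S x ≤ 2 * ‖x‖ := fun x =>
    supSeminorm_le hS (by positivity) fun g hg => hS g hg x
  have hSb : Bornology.IsBounded S := isBounded_iff_forall_norm_le.2
    ⟨2, fun g hg => g.opNorm_le_bound zero_le_two (hS g hg)⟩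
  obtain ⟨p, K, -, hp, hpS⟩ := exists_isLocallyFiniteSup (supSeminorm S) one_pos
    (fun x => by simpa using hlow x) hup (fun n => S ∩ E n)
    (fun n => totallyBounded_inter_of_finiteDimensional hSb (E n))
    (fun n g hg x => abs_le_supSeminorm hS hg.1 x)
    (by
      intro x hx
      obtain ⟨k, g₁, hg₁, hlt⟩ := hexists x hx
      obtain ⟨N, hN⟩ := htail x _ hlt
      choose m hm using hreplace x
      obtain ⟨M, hM⟩ := ((Set.finite_Iio (max N (k + 1))).image m).bddAbove
      have hbelow : ∀ n < max N (k + 1), ∀ g ∈ D n, ∃ g' ∈ S ∩ E M, g' x = g x := by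
        intro n hn g hg
        obtain ⟨g', h1, h2, h3⟩ := hm n g hg
        exact ⟨g', ⟨hDS n h1, hEmono (hM ⟨n, hn, rfl⟩) h2⟩, h3⟩
      refine ⟨M, fun δ hδ => ?_⟩
      by_contra! hcon
      obtain ⟨g₂, hg₂, e₂⟩ := hbelow k (by omega) g₁ hg₁
      have hle : supSeminorm S x ≤ supSeminorm S x - δ := by
        refine supSeminorm_le hS ((abs_nonneg _).trans (hcon g₂ hg₂)) fun g hg => ?_
        obtain ⟨n, hn⟩ := Set.mem_iUnion.1 hg
        rcases lt_or_ge n (max N (k + 1)) with hlt | hge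
        · obtain ⟨g', hg', e'⟩ := hbelow n hlt g hn
          exact e' ▸ hcon g' hg'
        · exact (hN n ((le_max_left _ _).trans hge) g hn).trans (e₂ ▸ hcon g₂ hg₂)
      linarith)
  refine ⟨p, K, hp, fun x => ⟨(hlow x).trans (hpS x).1, (hpS x).2.trans ?_⟩⟩
  linarith [hup x]

/-- The space `X` with a seminorm, to be used as its norm. -/
def Renormed {X : Type*} [NormedAddCommGroup X] [NormedSpace ℝ X] (_ : Seminorm ℝ X) : Type _ := X

namespace Renormed

variable {X : Type*} [NormedAddCommGroup X] [NormedSpace ℝ X] (q : Seminorm ℝ X)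

instance : AddCommGroup (Renormed q) := inferInstanceAs (AddCommGroup X)

instance : Module ℝ (Renormed q) := inferInstanceAs (Module ℝ X)

/-- The identity map to the renormed space. -/
def equiv : X ≃ₗ[ℝ] Renormed q := LinearEquiv.refl ℝ X

instance : Norm (Renormed q) := ⟨fun x => q ((equiv q).symm x)⟩

lemma norm_def (x : Renormed q) : ‖x‖ = q ((equiv q).symm x) := rfl

lemma core (hq : ∀ x, ‖x‖ ≤ q x) : NormedSpace.Core ℝ (Renormed q) where
  norm_nonneg x := apply_nonneg q _
  norm_smul c x := by rw [norm_def, map_smul, map_smul_eq_mul]; rfl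
  norm_triangle x y := by rw [norm_def, map_add]; exact map_add_le_add q _ _
  norm_eq_zero_iff x := by
    refine ⟨fun h => ?_, fun h => by rw [h, norm_def, map_zero, map_zero]⟩
    have h1 := hq ((equiv q).symm x)
    rw [← norm_def, h, norm_le_zero_iff] at h1
    exact (equiv q).symm.map_eq_zero_iff.1 h1

end Renormed

/-- A space with an equivalent norm that is a locally finite supremum is isomorphically
polyhedral. -/
lemma IsLocallyFiniteSup.isIsomorphicallyPolyhedral {X : Type*} [NormedAddCommGroup X]
    [NormedSpace ℝ X] {q : Seminorm ℝ X} {H : Set (X →L[ℝ] ℝ)} (hq : IsLocallyFiniteSup q H)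
    {C : ℝ} (hcq : ∀ x, ‖x‖ ≤ q x) (hqC : ∀ x, q x ≤ C * ‖x‖) :
    IsIsomorphicallyPolyhedral X := by
  let e := Renormed.equiv q
  let _ : NormedAddCommGroup (Renormed q) := NormedAddCommGroup.ofCore (Renormed.core q hcq)
  let _ : NormedSpace ℝ (Renormed q) := NormedSpace.ofCore (Renormed.core q hcq)
  refine ⟨Renormed q, inferInstance, inferInstance, fun S hS => ?_,
    ⟨e.toContinuousLinearEquivOfBounds C 1 (fun x => hqC x) fun x => ?_⟩⟩
  · let Z : Submodule ℝ X := S.map (e.symm : Renormed q →ₗ[ℝ] X)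
    have hZ : FiniteDimensional ℝ Z := inferInstanceAs (FiniteDimensional ℝ (S.map _))
    obtain ⟨F, hFH, hF, hFZ⟩ := hq.exists_finite Z
    let r : (X →L[ℝ] ℝ) → S →ₗ[ℝ] ℝ := fun h =>
      ((h : X →ₗ[ℝ] ℝ).comp (e.symm : Renormed q →ₗ[ℝ] X)).comp S.subtype
    suffices hball : Metric.closedBall (0 : S) 1 =
        {z | ∀ f ∈ r '' F ∪ (fun h => -r h) '' F, f z ≤ 1} by
      rw [hball]
      exact finite_extremePoints_of_finite_ineq ((hF.image r).union (hF.image fun h => -r h))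
    ext z
    have hz : ‖z‖ = q (e.symm z) := rfl
    rw [mem_closedBall_zero_iff, hz]
    constructor
    · rintro h1 _ (⟨h, hh, rfl⟩ | ⟨h, hh, rfl⟩)
      · exact (le_abs_self _).trans ((hq.1 h (hFH hh) _).trans h1)
      · exact (neg_le_abs _).trans ((hq.1 h (hFH hh) _).trans h1)
    · intro h1
      rcases eq_or_ne (e.symm (z : Renormed q)) 0 with h0 | h0
      · rw [h0, map_zero]
        exact zero_le_one
      · obtain ⟨h, hh, hhz⟩ := hFZ _ (Submodule.mem_map_of_mem z.2) h0
        refine hhz.symm.le.trans (abs_le.2 ⟨?_, h1 _ (Or.inl ⟨h, hh, rfl⟩)⟩)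
        have : -(h (e.symm z)) ≤ 1 := h1 _ (Or.inr ⟨h, hh, rfl⟩)
        change -1 ≤ h (e.symm z)
        linarith
  · rw [one_mul]
    exact hcq _

namespace c0Sum

variable {Y : ℕ → Type*} [∀ i, NormedAddCommGroup (Y i)] [∀ i, NormedSpace ℝ (Y i)]

lemma norm_coord_le (y : c0Sum Y) (i : ℕ) : ‖y.1 i‖ ≤ ‖y‖ :=
  lp.norm_apply_le_norm ENNReal.top_ne_zero y.1 i

lemma norm_le {y : c0Sum Y} {a : ℝ} (ha : 0 ≤ a) (h : ∀ i, ‖y.1 i‖ ≤ a) : ‖y‖ ≤ a :=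
  lp.norm_le_of_forall_le ha h

/-- The coordinate projections. -/
noncomputable def coord (i : ℕ) : c0Sum Y →L[ℝ] Y i :=
  LinearMap.mkContinuous
    { toFun := fun y => y.1 i
      map_add' := fun _ _ => rfl
      map_smul' := fun _ _ => rfl } 1 fun y => (norm_coord_le y i).trans (one_mul _).ge

lemma coord_apply (i : ℕ) (y : c0Sum Y) : coord i y = y.1 i := rfl

lemma tendsto_coord (y : c0Sum Y) : Tendsto (fun i => ‖y.1 i‖) atTop (𝓝 0) := y.2

/-- The inclusions of the summands. -/
noncomputable def single (i : ℕ) : Y i →ₗ[ℝ] c0Sum Y :=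
  (lp.lsingle ∞ i).codRestrict (c0Sum Y) fun a => by
    refine tendsto_const_nhds.congr' ?_
    filter_upwards [eventually_gt_atTop i] with j hj
    simp [lp.single_apply, hj.ne']

end c0Sum

namespace c0Sum

variable {Y : ℕ → Type*} [∀ i, NormedAddCommGroup (Y i)] [∀ i, NormedSpace ℝ (Y i)]

lemma single_apply_self (i : ℕ) (a : Y i) : (single i a).1 i = a :=
  lp.single_apply_self ∞ i a

lemma single_apply_ne {i j : ℕ} (h : j ≠ i) (a : Y i) : (single i a).1 j = 0 :=
  lp.single_apply_ne ∞ i a h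

lemma continuous_single (i : ℕ) : Continuous (single (Y := Y) i) := by
  refine AddMonoidHomClass.continuous_of_bound (single i) 1 fun a => ?_
  rw [one_mul]
  refine norm_le (norm_nonneg a) fun j => ?_
  rcases eq_or_ne j i with rfl | h
  · rw [single_apply_self]
  · rw [single_apply_ne h, norm_zero]
    exact norm_nonneg a

lemma sum_single_apply (y : c0Sum Y) (n j : ℕ) :
    (∑ i ∈ Finset.range n, single i (y.1 i)).1 j = if j < n then y.1 j else 0 := by
  rw [← coord_apply, map_sum]
  simp only [coord_apply]
  split_ifs with h
  · rw [Finset.sum_eq_single j (fun i _ hij => single_apply_ne hij.symm _)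
      (fun hj => absurd (Finset.mem_range.2 h) hj), single_apply_self]
  · refine Finset.sum_eq_zero fun i hi => single_apply_ne ?_ _
    rintro rfl
    exact h (Finset.mem_range.1 hi)

lemma exists_norm_coord_lt (y : c0Sum Y) {ε : ℝ} (hε : 0 < ε) : ∃ N, ∀ i ≥ N, ‖y.1 i‖ < ε :=
  eventually_atTop.1 ((tendsto_coord y).eventually_lt_const hε)

lemma separableSpace [∀ i, TopologicalSpace.SeparableSpace (Y i)] :
    TopologicalSpace.SeparableSpace (c0Sum Y) := by
  rw [← TopologicalSpace.isSeparable_univ_iff]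
  have hsep : TopologicalSpace.IsSeparable
      (closure (Submodule.span ℝ (⋃ i, Set.range (single (Y := Y) i)) : Set (c0Sum Y))) :=
    (TopologicalSpace.IsSeparable.span (TopologicalSpace.isSeparable_iUnion.2 fun i =>
      TopologicalSpace.isSeparable_range (continuous_single i))).closure
  refine hsep.mono fun y _ => Metric.mem_closure_iff.2 fun ε hε => ?_
  obtain ⟨N, hN⟩ := exists_norm_coord_lt y (half_pos hε)
  refine ⟨∑ i ∈ Finset.range N, single i (y.1 i), Submodule.sum_mem _ fun i _ =>
    Submodule.subset_span (Set.mem_iUnion.2 ⟨i, _, rfl⟩), ?_⟩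
  rw [dist_eq_norm]
  refine (norm_le (half_pos hε).le fun j => ?_).trans_lt (half_lt_self hε)
  rw [← coord_apply, map_sub, coord_apply, coord_apply, sum_single_apply]
  split_ifs with h
  · rw [sub_self, norm_zero]
    exact (half_pos hε).le
  · rw [sub_zero]
    exact (hN j (not_lt.1 h)).le

/-- Locally finite suprema on the summands, with uniform equivalence constants, yield a locally
finite supremum on the `c₀`-sum. -/
lemma exists_isLocallyFiniteSup {p : ∀ i, Seminorm ℝ (Y i)} {H : ∀ i, Set (Y i →L[ℝ] ℝ)}
    (hp : ∀ i, IsLocallyFiniteSup (p i) (H i)) {C : ℝ} (hC : 0 < C)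
    (hpC : ∀ i x, ‖x‖ ≤ p i x ∧ p i x ≤ C * ‖x‖) :
    ∃ (P : Seminorm ℝ (c0Sum Y)) (K : Set (c0Sum Y →L[ℝ] ℝ)), IsLocallyFiniteSup P K ∧
      ∀ y, ‖y‖ ≤ P y ∧ P y ≤ C * ‖y‖ := by
  let K : Set (c0Sum Y →L[ℝ] ℝ) := ⋃ i, (fun h => h.comp (coord i)) '' H i
  have hK : ∀ g ∈ K, ∀ y, |g y| ≤ C * ‖y‖ := by
    intro g hg y
    obtain ⟨i, h, hh, rfl⟩ := Set.mem_iUnion.1 hg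
    exact ((hp i).1 h hh _).trans ((hpC i _).2.trans
      (mul_le_mul_of_nonneg_left (norm_coord_le y i) hC.le))
  have hmem : ∀ i, ∀ h ∈ H i, h.comp (coord i) ∈ K := fun i h hh =>
    Set.mem_iUnion.2 ⟨i, h, hh, rfl⟩
  have hlow : ∀ y, ‖y‖ ≤ supSeminorm K y := by
    refine fun y => norm_le (apply_nonneg _ _) fun i => ?_
    rcases eq_or_ne (y.1 i) 0 with h0 | h0
    · rw [h0, norm_zero]
      exact apply_nonneg _ _
    · obtain ⟨F, hFH, -, hF⟩ := (hp i).2 _ h0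
      obtain ⟨h, hh, e⟩ := hF.self_of_nhds
      exact (hpC i _).1.trans (e ▸ abs_le_supSeminorm hK (hmem i h (hFH hh)) y)
  refine ⟨supSeminorm K, K, ⟨fun g hg y => abs_le_supSeminorm hK hg y, fun y hy => ?_⟩,
    fun y => ⟨hlow y, supSeminorm_le hK (by positivity) fun g hg => hK g hg y⟩⟩
  have hy0 : 0 < ‖y‖ := norm_pos_iff.2 hy
  set η := ‖y‖ / (4 * C) with hη_def
  have hη : 0 < η := by positivity
  obtain ⟨N, hN⟩ := exists_norm_coord_lt y hη
  have hloc : ∀ i, ∃ F ⊆ H i, F.Finite ∧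
      ∀ᶠ z in 𝓝 y, y.1 i ≠ 0 → ∃ h ∈ F, |h (z.1 i)| = p i (z.1 i) := by
    intro i
    by_cases h0 : y.1 i = 0
    · exact ⟨∅, Set.empty_subset _, Set.finite_empty,
        Eventually.of_forall fun z h => absurd h0 h⟩
    · obtain ⟨F, h1, h2, h3⟩ := (hp i).2 _ h0
      exact ⟨F, h1, h2, (((coord i).continuous.tendsto y).eventually h3).mono fun z hz _ => hz⟩
  choose F hFH hF hFev using hloc
  set G : Set (c0Sum Y →L[ℝ] ℝ) := ⋃ i ∈ Set.Iio N, (fun h => h.comp (coord i)) '' F i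
  have hG : G.Finite := (Set.finite_Iio N).biUnion fun i _ => (hF i).image _
  have hGK : G ⊆ K := by
    refine Set.iUnion₂_subset fun i _ => ?_
    rintro _ ⟨h, hh, rfl⟩
    exact hmem i h (hFH i hh)
  refine ⟨G, hGK, hG, ?_⟩
  have hball : ∀ᶠ z in 𝓝 y, ‖z - y‖ < min η (‖y‖ / 4) := by
    have := Metric.ball_mem_nhds y (lt_min hη (by positivity : 0 < ‖y‖ / 4))
    filter_upwards [this] with z hz
    rwa [← dist_eq_norm]
  filter_upwards [hball, (eventually_all_finset (Finset.range N)).2 fun i _ => hFev i]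
    with z hz hzF
  have hzη := hz.trans_le (min_le_left _ _)
  have hz4 := hz.trans_le (min_le_right _ _)
  have hPz : ‖y‖ / 2 < supSeminorm K z := by
    have h1 : ‖y‖ ≤ ‖z‖ + ‖z - y‖ := by simpa using norm_sub_le z (z - y)
    have h2 := hlow z
    linarith
  have hsmall : ∀ i, ‖y.1 i‖ < η → p i (z.1 i) ≤ ‖y‖ / 2 := by
    intro i hi
    have h1 : ‖z.1 i‖ ≤ ‖(z - y).1 i‖ + ‖y.1 i‖ := by
      simpa using norm_add_le (z.1 i - y.1 i) (y.1 i)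
    have h2 := norm_coord_le (z - y) i
    have h3 : ‖z.1 i‖ ≤ 2 * η := by linarith
    calc p i (z.1 i) ≤ C * ‖z.1 i‖ := (hpC i _).2
      _ ≤ C * (2 * η) := by gcongr
      _ = ‖y‖ / 2 := by rw [hη_def]; field_simp; norm_num
  have hdom : ∀ g ∈ K, |g z| ≤ ‖y‖ / 2 ∨ ∃ g' ∈ G, |g z| ≤ |g' z| := by
    intro g hg
    obtain ⟨i, h, hh, rfl⟩ := Set.mem_iUnion.1 hg
    have h1 : |h (z.1 i)| ≤ p i (z.1 i) := (hp i).1 h hh _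
    by_cases hi : ‖y.1 i‖ < η
    · exact Or.inl (h1.trans (hsmall i hi))
    · have hiN : i < N := by
        by_contra hcon
        exact hi (hN i (not_lt.1 hcon))
      have h0 : y.1 i ≠ 0 := fun h => hi (by rwa [h, norm_zero])
      obtain ⟨h', hh', e⟩ := hzF i (Finset.mem_range.2 hiN) h0
      exact Or.inr ⟨_, Set.mem_biUnion hiN ⟨h', hh', rfl⟩, h1.trans e.symm.le⟩
  rcases G.eq_empty_or_nonempty with hGe | hGn
  · refine absurd hPz (not_lt.2 (supSeminorm_le hK (by positivity) fun g hg => ?_))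
    rcases hdom g hg with h | ⟨g', hg', -⟩
    · exact h
    · rw [hGe] at hg'
      exact absurd hg' (Set.notMem_empty _)
  · obtain ⟨k, hk, hmax⟩ := Set.exists_max_image G (fun g => |g z|) hG hGn
    refine ⟨k, hk, le_antisymm (abs_le_supSeminorm hK (hGK hk) z) ?_⟩
    have hle : supSeminorm K z ≤ max (‖y‖ / 2) |k z| := by
      refine supSeminorm_le hK (le_max_of_le_right (abs_nonneg _)) fun g hg => ?_
      rcases hdom g hg with h | ⟨g', hg', h⟩
      · exact h.trans (le_max_left _ _)
      · exact (h.trans (hmax g' hg')).trans (le_max_right _ _)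
    exact (le_max_iff.1 hle).resolve_left (not_le.2 hPz)

end c0Sum

theorem c0Sum_separable_isomorphically_polyhedral
    (Y : ℕ → Type) [∀ i, NormedAddCommGroup (Y i)] [∀ i, NormedSpace ℝ (Y i)]
    [∀ i, CompleteSpace (Y i)] [∀ i, TopologicalSpace.SeparableSpace (Y i)]
    (hY : ∀ i, IsIsomorphicallyPolyhedral (Y i)) :
    TopologicalSpace.SeparableSpace (c0Sum Y) ∧ IsIsomorphicallyPolyhedral (c0Sum Y) := by
  refine ⟨c0Sum.separableSpace, ?_⟩
  have hren : ∀ i, ∃ (p : Seminorm ℝ (Y i)) (K : Set (Y i →L[ℝ] ℝ)), IsLocallyFiniteSup p K ∧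
      ∀ x, ‖x‖ ≤ p x ∧ p x ≤ 4 * ‖x‖ := by
    intro i
    obtain ⟨q, H, c, C, hH, hq, hc, hcq, hqC⟩ := (hY i).exists_isLocallyFiniteSup
    exact hq.exists_uniform hH hc hcq hqC
  choose p H hp hpC using hren
  obtain ⟨P, K, hP, hPC⟩ := c0Sum.exists_isLocallyFiniteSup hp (by norm_num) hpC
  exact hP.isIsomorphicallyPolyhedral (fun y => (hPC y).1) fun y => (hPC y).2
end

section
/- If a Banach space $X$ is isomorphically polyhedral, then $X$ is $c_0$-saturated: every infinite-dimensional closed subspace of $X$ contains an isomorphic copy of $c_0$. -/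
open NormedSpace
open scoped ZeroAtInfty

open Filter Topology

/-- The norm is locally the restriction of a functional along every ray. -/
def NormLocallyLinearOnRays (E : Type*) [NormedAddCommGroup E] [NormedSpace ℝ E] : Prop :=
  ∀ x z : E, ∃ ε : ℝ, 0 < ε ∧ ∃ g : E →L[ℝ] ℝ, ‖g‖ ≤ 1 ∧
    ∀ t, 0 ≤ t → t ≤ ε → g (x + t • z) = ‖x + t • z‖

section Rays

variable {E : Type*} [NormedAddCommGroup E] [NormedSpace ℝ E]

theorem apply_le_norm {g : E →L[ℝ] ℝ} (hg : ‖g‖ ≤ 1) (x : E) : g x ≤ ‖x‖ :=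
  (le_abs_self _).trans (g.le_of_opNorm_le hg x |>.trans_eq (one_mul _))

theorem abs_apply_le_norm {g : E →L[ℝ] ℝ} (hg : ‖g‖ ≤ 1) (x : E) : |g x| ≤ ‖x‖ :=
  g.le_of_opNorm_le hg x |>.trans_eq (one_mul _)

theorem exists_support_functional (x : E) : ∃ g : E →L[ℝ] ℝ, ‖g‖ ≤ 1 ∧ g x = ‖x‖ := by
  obtain ⟨g, hg, hx⟩ := exists_dual_vector'' ℝ x
  exact ⟨g, hg, by simpa using hx⟩

theorem apply_eq_one_of_mem_convexHull {s : Finset E} {g g' : E →L[ℝ] ℝ}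
    (hg : ∀ e ∈ s, g e ≤ 1) (hgg' : ∀ e ∈ s, g e = 1 → g' e = 1) {u : E}
    (hu : u ∈ convexHull ℝ (s : Set E)) (hgu : g u = 1) : g' u = 1 := by
  obtain ⟨w, hw0, hw1, rfl⟩ := Finset.mem_convexHull'.1 hu
  simp only [map_sum, map_smul, smul_eq_mul] at hgu ⊢
  have h0 : ∑ e ∈ s, w e * (1 - g e) = 0 := by
    simp only [mul_sub, mul_one, Finset.sum_sub_distrib, hw1, hgu, sub_self]
  have h1 := (Finset.sum_eq_zero_iff_of_nonneg
    (fun e he => mul_nonneg (hw0 e he) (sub_nonneg.2 (hg e he)))).1 h0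
  rw [← hw1]
  refine Finset.sum_congr rfl fun e he => ?_
  rcases mul_eq_zero.1 (h1 e he) with h | h
  · simp [h]
  · rw [hgg' e he (by linarith), mul_one]

/-- The unit ball of a finite-dimensional subspace of a polyhedral space is the convex hull of a
finite set. -/
theorem IsPolyhedral.exists_finset_convexHull (hE : IsPolyhedral E) (S : Subspace ℝ E)
    [FiniteDimensional ℝ S] :
    ∃ s : Finset E, (∀ e ∈ s, ‖e‖ ≤ 1) ∧
      ∀ u ∈ S, ‖u‖ ≤ 1 → u ∈ convexHull ℝ (s : Set E) := by
  classical
  have hfin := hE S inferInstance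
  have : ProperSpace S := FiniteDimensional.proper ℝ S
  have hKM := closure_convexHull_extremePoints (isCompact_closedBall (0 : S) 1)
    (convex_closedBall (0 : S) 1)
  rw [(hfin.isClosed_convexHull ℝ).closure_eq] at hKM
  refine ⟨hfin.toFinset.image S.subtype, ?_, ?_⟩
  · intro e he
    obtain ⟨v, hv, rfl⟩ := Finset.mem_image.1 he
    have := extremePoints_subset (hfin.mem_toFinset.1 hv)
    simpa using this
  · intro u hu hu1
    have hmem : (⟨u, hu⟩ : S) ∈ Metric.closedBall (0 : S) 1 := by simpa using hu1
    rw [← hKM] at hmem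
    have := Set.mem_image_of_mem S.subtype hmem
    rw [S.subtype.image_convexHull] at this
    simpa using this

theorem IsPolyhedral.normLocallyLinearOnRays (hE : IsPolyhedral E) :
    NormLocallyLinearOnRays E := by
  classical
  intro x z
  have : FiniteDimensional ℝ (Submodule.span ℝ {x, z}) :=
    FiniteDimensional.span_of_finite ℝ (by simp)
  obtain ⟨s, hs1, hs⟩ := hE.exists_finset_convexHull (Submodule.span ℝ {x, z})
  choose g hg1 hg using fun t : ℝ => exists_support_functional (x + t • z)
  let F : ℕ → Finset E := fun n => s.filter fun e => g (1 / ((n : ℝ) + 1)) e = 1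
  obtain ⟨A, hA⟩ : ∃ A ∈ s.powerset, ∃ᶠ n in atTop, F n = A := by
    by_contra! H
    have : ∀ᶠ n in atTop, ∀ A ∈ s.powerset, F n ≠ A :=
      (s.powerset.eventually_all).2 fun A hA => by simpa using H A hA
    obtain ⟨n, hn⟩ := this.exists
    exact hn (F n) (Finset.mem_powerset.2 (Finset.filter_subset _ _)) rfl
  obtain ⟨n₀, hn₀⟩ := hA.2.exists
  have key : ∀ n, F n = A →
      g (1 / ((n₀ : ℝ) + 1)) (x + (1 / ((n : ℝ) + 1)) • z) = ‖x + (1 / ((n : ℝ) + 1)) • z‖ := by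
    intro n hn
    set u := x + (1 / ((n : ℝ) + 1)) • z with hu
    rcases eq_or_ne u 0 with h0 | h0
    · simp [h0]
    have hpos : 0 < ‖u‖ := norm_pos_iff.2 h0
    have huS : u ∈ Submodule.span ℝ {x, z} :=
      Submodule.add_mem _ (Submodule.subset_span (by simp))
        (Submodule.smul_mem _ _ (Submodule.subset_span (by simp)))
    have h1 : g (1 / ((n₀ : ℝ) + 1)) (‖u‖⁻¹ • u) = 1 := by
      refine apply_eq_one_of_mem_convexHull (g := g (1 / ((n : ℝ) + 1)))
        (fun e he => (apply_le_norm (hg1 _) e).trans (hs1 e he)) ?_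
        (hs _ (Submodule.smul_mem _ ‖u‖⁻¹ huS) (by simp [norm_smul, hpos.ne'])) ?_
      · intro e he h
        have : e ∈ F n := Finset.mem_filter.2 ⟨he, h⟩
        rw [hn, ← hn₀] at this
        exact (Finset.mem_filter.1 this).2
      · rw [map_smul, hu, hg, ← hu, smul_eq_mul, inv_mul_cancel₀ hpos.ne']
    rw [map_smul, smul_eq_mul] at h1
    field_simp at h1
    exact h1
  set γ := g (1 / ((n₀ : ℝ) + 1))
  have hpos : ∀ t, 0 < t → t ≤ 1 / ((n₀ : ℝ) + 1) → γ (x + t • z) = ‖x + t • z‖ := by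
    intro t ht0 ht1
    obtain ⟨n, hnA, hnt⟩ := (hA.2.and_eventually
      ((tendsto_one_div_add_atTop_nhds_zero_nat (𝕜 := ℝ)).eventually_lt_const ht0)).exists
    have ha := key n hnA
    have hb := key n₀ hn₀
    set a := 1 / ((n : ℝ) + 1)
    set b := 1 / ((n₀ : ℝ) + 1)
    refine le_antisymm (apply_le_norm (hg1 _) _) ?_
    have hab : 0 < b - a := by linarith
    have hcomb : (b - a) • (x + t • z) = (b - t) • (x + a • z) + (t - a) • (x + b • z) := by
      module
    have h1 : (b - a) * ‖x + t • z‖ ≤ (b - t) * ‖x + a • z‖ + (t - a) * ‖x + b • z‖ := by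
      calc (b - a) * ‖x + t • z‖ = ‖(b - a) • (x + t • z)‖ := by
            rw [norm_smul, Real.norm_of_nonneg hab.le]
        _ ≤ _ := by
            rw [hcomb]
            refine (norm_add_le _ _).trans_eq ?_
            rw [norm_smul, norm_smul, Real.norm_of_nonneg (by linarith),
              Real.norm_of_nonneg (by linarith)]
    have h2 := congrArg γ hcomb
    simp only [map_add γ ((b - t) • _), map_smul γ (_ - _), smul_eq_mul, ha, hb] at h2
    exact le_of_mul_le_mul_left (h1.trans_eq h2.symm) hab
  refine ⟨1 / ((n₀ : ℝ) + 1), by positivity, γ, hg1 _, fun t ht0 ht1 => ?_⟩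
  rcases ht0.eq_or_lt with rfl | ht0
  · have hc1 : Tendsto (fun t : ℝ => γ (x + t • z)) (𝓝[>] 0) (𝓝 (γ (x + (0 : ℝ) • z))) :=
      (Continuous.tendsto (by fun_prop) 0).mono_left nhdsWithin_le_nhds
    have hc2 : Tendsto (fun t : ℝ => ‖x + t • z‖) (𝓝[>] 0) (𝓝 ‖x + (0 : ℝ) • z‖) :=
      (Continuous.tendsto (f := fun t : ℝ => ‖x + t • z‖) (by fun_prop) 0).mono_left
        nhdsWithin_le_nhds
    refine tendsto_nhds_unique (hc1.congr' ?_) hc2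
    filter_upwards [Ioc_mem_nhdsGT (show (0 : ℝ) < 1 / ((n₀ : ℝ) + 1) by positivity)] with t ht
    exact hpos t ht.1 ht.2
  · exact hpos t ht0 ht1

theorem NormLocallyLinearOnRays.submodule (hE : NormLocallyLinearOnRays E) (S : Submodule ℝ E) :
    NormLocallyLinearOnRays S := by
  intro x z
  obtain ⟨ε, hε, g, hg1, hg⟩ := hE x z
  refine ⟨ε, hε, g.comp S.subtypeL, ?_, fun t h0 h1 => by simpa using hg t h0 h1⟩
  exact ContinuousLinearMap.opNorm_le_bound _ zero_le_one fun v => by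
    simpa using abs_apply_le_norm hg1 (v : E)

end Rays

section Boundary

variable {E : Type*} [NormedAddCommGroup E] [NormedSpace ℝ E]

theorem NormLocallyLinearOnRays.dense_second_difference_lt (hE : NormLocallyLinearOnRays E)
    (z : E) {η : ℝ} (hη : 0 < η) :
    Dense {x : E | ∃ δ : ℝ, 0 < δ ∧ ‖x + δ • z‖ + ‖x - δ • z‖ - 2 * ‖x‖ < η * δ} := by
  intro x
  obtain ⟨ε, hε, g, -, hg⟩ := hE x z
  have hlim : Tendsto (fun t : ℝ => x + t • z) (𝓝[>] 0) (𝓝 x) := by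
    have : Tendsto (fun t : ℝ => x + t • z) (𝓝 0) (𝓝 (x + (0 : ℝ) • z)) :=
      Continuous.tendsto (by fun_prop) 0
    rw [zero_smul, add_zero] at this
    exact this.mono_left nhdsWithin_le_nhds
  refine mem_closure_of_tendsto hlim ?_
  filter_upwards [Ioc_mem_nhdsGT (show (0 : ℝ) < ε / 2 by positivity)] with t ht
  refine ⟨t, ht.1, ?_⟩
  have h1 : x + t • z + t • z = x + (2 * t) • z := by module
  have h2 : x + t • z - t • z = x + (0 : ℝ) • z := by module
  rw [h1, h2, ← hg _ (by linarith [ht.1]) (by linarith [ht.2]), ← hg 0 le_rfl hε.le,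
    ← hg t ht.1.le (by linarith [ht.2])]
  simp only [map_add, map_smul, smul_eq_mul]
  nlinarith [mul_pos hη ht.1]

theorem isOpen_second_difference_lt (z : E) (η : ℝ) :
    IsOpen {x : E | ∃ δ : ℝ, 0 < δ ∧ ‖x + δ • z‖ + ‖x - δ • z‖ - 2 * ‖x‖ < η * δ} := by
  simp only [Set.ofPred_exists, Set.ofPred_and]
  refine isOpen_iUnion fun δ => isOpen_const.inter ?_
  exact isOpen_lt (by fun_prop) (by fun_prop)

/-- A functional that agrees with the norm near the origin of every ray from `x` agrees with it
near `x`. -/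
theorem eventually_apply_eq_norm_of_rays [CompleteSpace E] {g : E →L[ℝ] ℝ} (hg1 : ‖g‖ ≤ 1) {x : E}
    (hg : ∀ z, ∃ ε : ℝ, 0 < ε ∧ ∀ t, 0 ≤ t → t ≤ ε → g (x + t • z) = ‖x + t • z‖) :
    ∀ᶠ u in 𝓝 x, g u = ‖u‖ := by
  have hadd : ∀ {a b : E}, g a = ‖a‖ → g b = ‖b‖ → g (a + b) = ‖a + b‖ := fun {a b} ha hb =>
    le_antisymm (apply_le_norm hg1 _) ((norm_add_le a b).trans (by rw [map_add, ha, hb]))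
  have hsmul : ∀ {a : E} {c : ℝ}, 0 ≤ c → g a = ‖a‖ → g (c • a) = ‖c • a‖ := fun {a c} hc ha => by
    rw [map_smul, ha, norm_smul, Real.norm_of_nonneg hc, smul_eq_mul]
  let A : ℕ → Set E := fun n => {z | g (((n : ℝ) + 1) • x + z) = ‖((n : ℝ) + 1) • x + z‖}
  have hAclosed : ∀ n, IsClosed (A n) := fun n => isClosed_eq (by fun_prop) (by fun_prop)
  have hAmem : ∀ z, ∃ n, z ∈ A n := by
    intro z
    obtain ⟨ε, hε, h⟩ := hg z
    obtain ⟨n, hn⟩ := exists_nat_one_div_lt hε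
    refine ⟨n, ?_⟩
    have := hsmul (c := (n : ℝ) + 1) (by positivity) (h _ (by positivity) hn.le)
    rwa [smul_add, smul_smul, mul_one_div_cancel (by positivity), one_smul] at this
  obtain ⟨n, z₀, hz₀⟩ := nonempty_interior_of_iUnion_of_closed hAclosed
    (Set.eq_univ_of_forall fun z => Set.mem_iUnion.2 (hAmem z))
  obtain ⟨m, hm⟩ := hAmem (-z₀)
  have hlim : Tendsto (fun u : E => ((n : ℝ) + m + 2) • (u - x) + z₀) (𝓝 x) (𝓝 z₀) := by
    have : Tendsto (fun u : E => ((n : ℝ) + m + 2) • (u - x) + z₀) (𝓝 x)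
      (𝓝 (((n : ℝ) + m + 2) • (x - x) + z₀)) := Continuous.tendsto (by fun_prop) x
    simpa using this
  filter_upwards [hlim (mem_interior_iff_mem_nhds.1 hz₀)] with u hu
  have h := hsmul (c := ((n : ℝ) + m + 2)⁻¹) (by positivity) (hadd hu hm)
  have hu' : ((n : ℝ) + m + 2)⁻¹ • (((n : ℝ) + 1) • x + (((n : ℝ) + m + 2) • (u - x) + z₀) +
      (((m : ℝ) + 1) • x + -z₀)) = u := by
    rw [inv_smul_eq_iff₀ (by positivity)]
    module
  rwa [hu'] at h

theorem NormLocallyLinearOnRays.dense_locally_linear [CompleteSpace E]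
    [TopologicalSpace.SeparableSpace E] (hE : NormLocallyLinearOnRays E) :
    Dense {x : E | ∃ g : E →L[ℝ] ℝ, ‖g‖ ≤ 1 ∧ ∀ᶠ u in 𝓝 x, g u = ‖u‖} := by
  let d := TopologicalSpace.denseSeq E
  have hd : DenseRange d := TopologicalSpace.denseRange_denseSeq E
  have hdense := dense_iInter_of_isOpen
    (fun p : ℕ × ℕ => isOpen_second_difference_lt (d p.1) (1 / ((p.2 : ℝ) + 1)))
    (fun p : ℕ × ℕ => hE.dense_second_difference_lt (d p.1)
      (show (0 : ℝ) < 1 / ((p.2 : ℝ) + 1) by positivity))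
  refine hdense.mono fun x hx => ?_
  simp only [Set.mem_iInter, Set.mem_ofPred_eq] at hx
  have hsmooth : ∀ z, ∀ η : ℝ, 0 < η →
      ∃ δ : ℝ, 0 < δ ∧ ‖x + δ • z‖ + ‖x - δ • z‖ - 2 * ‖x‖ < η * δ := by
    intro z η hη
    obtain ⟨n, hn⟩ := exists_nat_one_div_lt (show 0 < η / 3 by positivity)
    obtain ⟨k, hk⟩ := hd.exists_dist_lt z (show 0 < η / 3 by positivity)
    obtain ⟨δ, hδ, h⟩ := hx (k, n)
    refine ⟨δ, hδ, ?_⟩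
    rw [dist_eq_norm] at hk
    have e1 : x + δ • z = (x + δ • d k) + δ • (z - d k) := by module
    have e2 : x - δ • z = (x - δ • d k) - δ • (z - d k) := by module
    have hn' : ‖δ • (z - d k)‖ = δ * ‖z - d k‖ := by rw [norm_smul, Real.norm_of_nonneg hδ.le]
    have h1 := norm_add_le (x + δ • d k) (δ • (z - d k))
    have h2 := norm_sub_le (x - δ • d k) (δ • (z - d k))
    rw [← e1, hn'] at h1
    rw [← e2, hn'] at h2
    have h3 := mul_lt_mul_of_pos_left hk hδ
    have h4 := mul_lt_mul_of_pos_right hn hδ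
    simp only at h
    linarith
  obtain ⟨g, hg1, hgx⟩ := exists_support_functional x
  refine ⟨g, hg1, eventually_apply_eq_norm_of_rays hg1 fun z => ?_⟩
  obtain ⟨ε, hε, γ, hγ1, hγ⟩ := hE x z
  have hγx : γ x = ‖x‖ := by simpa using hγ 0 le_rfl hε.le
  have hle : g z ≤ γ z := by
    have h := apply_le_norm hg1 (x + ε • z)
    rw [← hγ ε hε.le le_rfl] at h
    simp only [map_add, map_smul, smul_eq_mul, hgx, hγx] at h
    exact le_of_mul_le_mul_left (by linarith) hε
  have hge : γ z ≤ g z := by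
    refine le_of_forall_pos_le_add fun η hη => ?_
    obtain ⟨δ, hδ, h⟩ := hsmooth z η hη
    have h1 := apply_le_norm hγ1 (x + δ • z)
    have h2 := apply_le_norm hg1 (x - δ • z)
    simp only [map_add, map_sub, map_smul, smul_eq_mul, hgx, hγx] at h1 h2
    exact le_of_mul_le_mul_left (by linarith) hδ
  refine ⟨ε, hε, fun t h0 h1 => ?_⟩
  rw [← hγ t h0 h1]
  simp only [map_add, map_smul, hgx, hγx, le_antisymm hle hge]

/-- The functionals that agree with the norm on some nonempty open set form a boundary. -/
theorem NormLocallyLinearOnRays.exists_boundary [CompleteSpace E]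
    [TopologicalSpace.SeparableSpace E] (hE : NormLocallyLinearOnRays E) (x : E) :
    ∃ g : E →L[ℝ] ℝ, (‖g‖ ≤ 1 ∧ (interior {u | g u = ‖u‖}).Nonempty) ∧ g x = ‖x‖ := by
  set W : Set E := {x : E | ∃ g : E →L[ℝ] ℝ, ‖g‖ ≤ 1 ∧ ∀ᶠ u in 𝓝 x, g u = ‖u‖} with hW
  have hWd : Dense W := hE.dense_locally_linear
  have hWo : IsOpen W := by
    simp only [hW, Set.ofPred_exists, Set.ofPred_and]
    exact isOpen_iUnion fun g => isOpen_const.inter isOpen_setOfPred_eventually_nhds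
  have hopen : ∀ n : ℕ, IsOpen {y : E | ∃ t : ℝ, (0 < t ∧ t < 1 / ((n : ℝ) + 1)) ∧ x + t • y ∈ W} := by
    intro n
    simp only [Set.ofPred_exists, Set.ofPred_and]
    exact isOpen_iUnion fun t =>
      (isOpen_const.inter isOpen_const).inter (hWo.preimage (by fun_prop))
  have hdense : ∀ n : ℕ,
      Dense {y : E | ∃ t : ℝ, (0 < t ∧ t < 1 / ((n : ℝ) + 1)) ∧ x + t • y ∈ W} := by
    intro n
    obtain ⟨t, ht0, ht1⟩ := exists_between (show (0 : ℝ) < 1 / ((n : ℝ) + 1) by positivity)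
    have hd : Dense ((fun y => x + t • y) ⁻¹' W) :=
      hWd.preimage ((Homeomorph.smulOfNeZero t ht0.ne').trans (Homeomorph.addLeft x)).isOpenMap
    exact hd.mono fun y hy => ⟨t, ⟨ht0, ht1⟩, hy⟩
  obtain ⟨y, hy⟩ := (dense_iInter_of_isOpen hopen hdense).nonempty
  obtain ⟨ε, hε, γ, hγ1, hγ⟩ := hE x y
  obtain ⟨n, hn⟩ := exists_nat_one_div_lt hε
  obtain ⟨t, ⟨ht0, ht1⟩, g, hg1, hg⟩ := Set.mem_iInter.1 hy n
  refine ⟨g, ⟨hg1, x + t • y, mem_interior_iff_mem_nhds.2 hg⟩, ?_⟩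
  have hlim : Tendsto (fun s : ℝ => x + s • y) (𝓝[>] t) (𝓝 (x + t • y)) :=
    (Continuous.tendsto (by fun_prop) t).mono_left nhdsWithin_le_nhds
  obtain ⟨s, hs, hs1⟩ := ((hlim.eventually hg).and
    (Ioc_mem_nhdsGT (show t < ε by linarith))).exists
  have h1 := hg.self_of_nhds
  rw [← hγ t ht0.le (by linarith)] at h1
  rw [← hγ s (by linarith [hs1.1]) hs1.2] at hs
  simp only [map_add, map_smul, smul_eq_mul] at h1 hs
  have hγx : γ x = ‖x‖ := by simpa using hγ 0 le_rfl hε.le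
  have hyy : (s - t) * (g y - γ y) = 0 := by linarith
  rcases mul_eq_zero.1 hyy with h | h
  · linarith [hs1.1]
  · have : g y = γ y := by linarith
    rw [this] at h1
    linarith

theorem eq_of_eventually_apply_eq {g g' : E →L[ℝ] ℝ} {x : E} (h : ∀ᶠ u in 𝓝 x, g u = g' u) :
    g = g' := by
  ext z
  have hlim : Tendsto (fun s : ℝ => x + s • z) (𝓝[>] 0) (𝓝 x) := by
    have : Tendsto (fun t : ℝ => x + t • z) (𝓝 0) (𝓝 (x + (0 : ℝ) • z)) :=
      Continuous.tendsto (by fun_prop) 0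
    rw [zero_smul, add_zero] at this
    exact this.mono_left nhdsWithin_le_nhds
  obtain ⟨s, hs, hs0⟩ := ((hlim.eventually h).and self_mem_nhdsWithin).exists
  have h0 := h.self_of_nhds
  simp only [map_add, map_smul, h0, smul_eq_mul, add_right_inj] at hs
  exact mul_left_cancel₀ (ne_of_gt hs0) hs

theorem NormLocallyLinearOnRays.exists_countable_boundary [CompleteSpace E]
    [TopologicalSpace.SeparableSpace E] (hE : NormLocallyLinearOnRays E) :
    ∃ f : ℕ → E →L[ℝ] ℝ, (∀ n, ‖f n‖ ≤ 1) ∧ ∀ x, ∃ n, f n x = ‖x‖ := by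
  let B : Set (E →L[ℝ] ℝ) := {g | ‖g‖ ≤ 1 ∧ (interior {u | g u = ‖u‖}).Nonempty}
  have hcount : B.Countable := by
    refine Set.PairwiseDisjoint.countable_of_isOpen (s := fun g => interior {u | g u = ‖u‖}) ?_
      (fun g _ => isOpen_interior) fun g hg => hg.2
    intro g _ g' _ hne
    refine Set.disjoint_left.2 fun u hu hu' => hne ?_
    refine eq_of_eventually_apply_eq (x := u) ?_
    filter_upwards [mem_interior_iff_mem_nhds.1 hu, mem_interior_iff_mem_nhds.1 hu'] with v h h'
    exact Eq.trans h (Eq.symm h')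
  obtain ⟨g₀, hg₀, -⟩ := hE.exists_boundary 0
  obtain ⟨f, hf⟩ := hcount.exists_eq_range ⟨g₀, hg₀⟩
  refine ⟨f, fun n => ?_, fun x => ?_⟩
  · exact (hf ▸ Set.mem_range_self n : f n ∈ B).1
  · obtain ⟨g, hg, hx⟩ := hE.exists_boundary x
    obtain ⟨n, rfl⟩ := (hf ▸ hg : g ∈ Set.range f)
    exact ⟨n, hx⟩

end Boundary

/-- `E` contains an isomorphic copy of `c₀`. -/
def ContainsC0 (E : Type*) [NormedAddCommGroup E] [NormedSpace ℝ E] : Prop :=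
  ∃ f : C₀(ℕ, ℝ) →L[ℝ] E, ∃ c : ℝ, 0 < c ∧ ∀ y : C₀(ℕ, ℝ), c * ‖y‖ ≤ ‖f y‖

section Embedding

variable {E : Type*} [NormedAddCommGroup E] [NormedSpace ℝ E]

theorem norm_apply_le_norm_zeroAtInfty (a : C₀(ℕ, ℝ)) (k : ℕ) : |a k| ≤ ‖a‖ := by
  have := a.toBCF.norm_coe_le_norm k
  simpa [ZeroAtInftyContinuousMap.norm_toBCF_eq_norm] using this

theorem containsC0_of_basic [CompleteSpace E] {u : ℕ → E} {ε : ℝ} (hε : 0 < ε)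
    (hu : ∀ k, ε ≤ ‖u k‖)
    (hub : ∀ a : ℕ → ℝ, (∀ k, |a k| ≤ 1) → ∀ n, ‖∑ k ∈ Finset.range n, a k • u k‖ ≤ 1)
    (hb : ∀ (a : ℕ → ℝ) (n l : ℕ), n ≤ l →
      ‖∑ k ∈ Finset.range n, a k • u k‖ ≤ 2 * ‖∑ k ∈ Finset.range l, a k • u k‖) :
    ContainsC0 E := by
  have hfin : ∀ (t : Finset ℕ) (a : ℕ → ℝ) (C : ℝ), 0 < C → (∀ k ∈ t, |a k| ≤ C) →
      ‖∑ k ∈ t, a k • u k‖ ≤ C := by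
    intro t a C hC ha
    obtain ⟨n, hn⟩ := t.exists_nat_subset_range
    have h := hub (fun k => if k ∈ t then C⁻¹ * a k else 0) (fun k => by
      by_cases hk : k ∈ t
      · rw [if_pos hk, abs_mul, abs_of_pos (inv_pos.2 hC), inv_mul_le_iff₀ hC, mul_one]
        exact ha k hk
      · simp [hk]) n
    have hsum : ∑ k ∈ Finset.range n, (if k ∈ t then C⁻¹ * a k else 0) • u k =
        C⁻¹ • ∑ k ∈ t, a k • u k := by
      rw [Finset.smul_sum, ← Finset.sum_subset hn (fun k _ hk => by simp [hk])]
      exact Finset.sum_congr rfl fun k hk => by rw [if_pos hk, smul_smul]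
    rwa [hsum, norm_smul, norm_inv, Real.norm_of_nonneg hC.le, inv_mul_le_iff₀ hC, mul_one] at h
  have hsummable : ∀ a : C₀(ℕ, ℝ), Summable fun k => a k • u k := by
    intro a
    refine summable_iff_vanishing_norm.2 fun η hη => ?_
    have hlim : Tendsto a atTop (𝓝 0) := by
      have := a.zero_at_infty'
      rwa [cocompact_eq_atTop] at this
    obtain ⟨N, hN⟩ := Metric.tendsto_atTop.1 hlim (η / 2) (by positivity)
    refine ⟨Finset.range N, fun t ht => ?_⟩
    refine (hfin t a (η / 2) (by positivity) fun k hk => ?_).trans_lt (by linarith)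
    have hkN : N ≤ k := by
      by_contra! hlt
      exact Finset.disjoint_left.1 ht hk (Finset.mem_range.2 hlt)
    simpa using (hN k hkN).le
  have hbound : ∀ a : C₀(ℕ, ℝ), ‖∑' k, a k • u k‖ ≤ 1 * ‖a‖ := by
    intro a
    refine le_of_forall_pos_le_add fun η hη => ?_
    refine le_of_tendsto (hsummable a).hasSum.tendsto_sum_nat.norm (Eventually.of_forall fun n => ?_)
    refine hfin _ a _ (by positivity) fun k _ => ?_
    linarith [norm_apply_le_norm_zeroAtInfty a k]
  let T : C₀(ℕ, ℝ) →ₗ[ℝ] E :=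
    { toFun := fun a => ∑' k, a k • u k
      map_add' := fun a b => by
        rw [← (hsummable a).tsum_add (hsummable b)]
        exact tsum_congr fun k => add_smul _ _ _
      map_smul' := fun c a => by
        rw [RingHom.id_apply, ← (hsummable a).tsum_const_smul]
        exact tsum_congr fun k => mul_smul _ _ _ }
  refine ⟨T.mkContinuous 1 hbound, ε / 4, by positivity, fun a => ?_⟩
  change _ ≤ ‖∑' k, a k • u k‖
  have hpart : ∀ n, ‖∑ k ∈ Finset.range n, a k • u k‖ ≤ 2 * ‖∑' k, a k • u k‖ := fun n =>
    ge_of_tendsto ((hsummable a).hasSum.tendsto_sum_nat.norm.const_mul 2)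
      ((eventually_ge_atTop n).mono fun l hl => hb a n l hl)
  have hcoord : ∀ k, |a k| ≤ (4 / ε) * ‖∑' k, a k • u k‖ := by
    intro k
    have h1 : ‖a k • u k‖ ≤ 4 * ‖∑' k, a k • u k‖ := by
      have h := norm_sub_le (∑ i ∈ Finset.range (k + 1), a i • u i)
        (∑ i ∈ Finset.range k, a i • u i)
      rw [Finset.sum_range_succ, add_sub_cancel_left, ← Finset.sum_range_succ] at h
      linarith [hpart k, hpart (k + 1)]
    rw [norm_smul, Real.norm_eq_abs] at h1
    have h2 := mul_le_mul_of_nonneg_left (hu k) (abs_nonneg (a k))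
    rw [div_mul_eq_mul_div, le_div_iff₀ hε]
    linarith
  have hnorm : ‖a‖ ≤ (4 / ε) * ‖∑' k, a k • u k‖ := by
    rw [← ZeroAtInftyContinuousMap.norm_toBCF_eq_norm]
    exact (BoundedContinuousFunction.norm_le (by positivity)).2 hcoord
  calc ε / 4 * ‖a‖ ≤ ε / 4 * ((4 / ε) * ‖∑' k, a k • u k‖) := by gcongr
    _ = _ := by field_simp

/-- The combinations of `h n, …, h (l - 1)` with coefficients in `[-1, 1]`. -/
def blockSums (h : ℕ → E) (n l : ℕ) : Set E :=
  {v | ∃ c : ℕ → ℝ, (∀ i, |c i| ≤ 1) ∧ v = ∑ i ∈ Finset.Ico n l, c i • h i}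

theorem zero_mem_blockSums (h : ℕ → E) (n l : ℕ) : (0 : E) ∈ blockSums h n l :=
  ⟨0, by simp, by simp⟩

theorem smul_mem_blockSums_succ (h : ℕ → E) (n : ℕ) {t : ℝ} (ht : |t| ≤ 1) :
    t • h n ∈ blockSums h n (n + 1) :=
  ⟨fun _ => t, fun _ => ht, by simp⟩

theorem add_smul_mem_blockSums {h : ℕ → E} {n l p : ℕ} (hnl : n ≤ l) (hlp : l ≤ p) {v w : E}
    (hv : v ∈ blockSums h n l) (hw : w ∈ blockSums h l p) {a : ℝ} (ha : |a| ≤ 1) :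
    v + a • w ∈ blockSums h n p := by
  obtain ⟨c, hc, rfl⟩ := hv
  obtain ⟨d, hd, rfl⟩ := hw
  refine ⟨fun i => if i < l then c i else a * d i, fun i => ?_, ?_⟩
  · by_cases hi : i < l
    · simpa [hi] using hc i
    · simp only [hi, if_false, abs_mul]
      exact mul_le_one₀ ha (abs_nonneg _) (hd i)
  · rw [← Finset.sum_Ico_consecutive _ hnl hlp, Finset.smul_sum]
    congr 1
    · exact Finset.sum_congr rfl fun i hi => by
        simp only [if_pos (Finset.mem_Ico.1 hi).2]
    · exact Finset.sum_congr rfl fun i hi => by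
        simp only [if_neg (not_lt.2 (Finset.mem_Ico.1 hi).1), smul_smul]

theorem mem_span_of_mem_blockSums {h : ℕ → E} {n l : ℕ} {v : E} (hv : v ∈ blockSums h n l)
    {S : Submodule ℝ E} (hS : ∀ i, n ≤ i → i < l → h i ∈ S) : v ∈ S := by
  obtain ⟨c, -, rfl⟩ := hv
  exact S.sum_mem fun i hi =>
    S.smul_mem _ (hS i (Finset.mem_Ico.1 hi).1 (Finset.mem_Ico.1 hi).2)

theorem containsC0_or_blockSums_small [CompleteSpace E] {h : ℕ → E}
    (hub : ∀ n, ∀ v ∈ blockSums h 0 n, ‖v‖ ≤ 1)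
    {F Z : ℕ → Submodule ℝ E} (hF : ∀ n i, i < n → h i ∈ F n) (hZ : ∀ n i, n ≤ i → h i ∈ Z n)
    (hFZ : ∀ n, ∀ x ∈ F n, ∀ y ∈ Z n, ‖x‖ ≤ 2 * ‖x + y‖) :
    ContainsC0 E ∨ ∀ ε > 0, ∃ n, ∀ l, n ≤ l → ∀ v ∈ blockSums h n l, ‖v‖ < ε := by
  refine or_iff_not_imp_right.2 fun hne => ?_
  push Not at hne
  obtain ⟨ε, hε, H⟩ := hne
  choose L hL V hV hVε using H
  let N : ℕ → ℕ := fun k => L^[k] 0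
  have hN : ∀ k, N (k + 1) = L (N k) := fun k => Function.iterate_succ_apply' L k 0
  have hNmono : Monotone N := monotone_nat_of_le_succ fun k => (hL _).trans_eq (hN k).symm
  have hVN : ∀ k, V (N k) ∈ blockSums h (N k) (N (k + 1)) := fun k => hN k ▸ hV (N k)
  refine containsC0_of_basic (u := fun k => V (N k)) hε (fun k => hVε _) ?_ ?_
  · intro a ha n
    refine hub (N n) _ ?_
    induction n with
    | zero => simpa using zero_mem_blockSums h 0 _
    | succ n ih =>
      rw [Finset.sum_range_succ]
      exact add_smul_mem_blockSums (Nat.zero_le _) (hNmono n.le_succ) ih (hVN n) (ha n)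
  · intro a n l hnl
    rw [← Finset.sum_range_add_sum_Ico _ hnl]
    refine hFZ (N n) _ (Submodule.sum_mem _ fun k hk => Submodule.smul_mem _ _ ?_) _
      (Submodule.sum_mem _ fun k hk => Submodule.smul_mem _ _ ?_)
    · exact mem_span_of_mem_blockSums (hVN k) fun i _ hi =>
        hF _ _ (hi.trans_le (hNmono (Finset.mem_range.1 hk)))
    · exact mem_span_of_mem_blockSums (hVN k) fun i hi _ =>
        hZ _ _ ((hNmono (Finset.mem_Ico.1 hk).1).trans hi)

end Embedding

section CountableBoundary

variable {E : Type*} [NormedAddCommGroup E] [NormedSpace ℝ E]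

/-- The common kernel of `f 0, …, f m`. -/
def commonKer (f : ℕ → E →L[ℝ] ℝ) (m : ℕ) : Submodule ℝ E :=
  ⨅ n : Fin (m + 1), LinearMap.ker (f n : E →ₗ[ℝ] ℝ)

theorem mem_commonKer {f : ℕ → E →L[ℝ] ℝ} {m : ℕ} {x : E} :
    x ∈ commonKer f m ↔ ∀ n, n ≤ m → f n x = 0 := by
  simp only [commonKer, Submodule.mem_iInf, LinearMap.mem_ker]
  exact ⟨fun h n hn => h ⟨n, Nat.lt_succ_of_le hn⟩, fun h n => h n (Nat.le_of_lt_succ n.2)⟩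

theorem commonKer_antitone (f : ℕ → E →L[ℝ] ℝ) : Antitone (commonKer f) := fun _ _ hmn _ hx =>
  mem_commonKer.2 fun n hn => mem_commonKer.1 hx n (hn.trans hmn)

theorem exists_mem_commonKer_norm_eq (hE : ¬ FiniteDimensional ℝ E) (f : ℕ → E →L[ℝ] ℝ) (m : ℕ)
    {r : ℝ} (hr : 0 ≤ r) : ∃ h ∈ commonKer f m, ‖h‖ = r := by
  have : ∃ v ∈ commonKer f m, v ≠ 0 := by
    by_contra! H
    refine hE (FiniteDimensional.of_injective
      (LinearMap.pi fun n : Fin (m + 1) => (f n : E →ₗ[ℝ] ℝ)) ?_)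
    refine (injective_iff_map_eq_zero _).2 fun v hv => H v (mem_commonKer.2 fun n hn => ?_)
    exact congrFun hv ⟨n, Nat.lt_succ_of_le hn⟩
  obtain ⟨v, hv, hv0⟩ := this
  refine ⟨(r / ‖v‖) • v, Submodule.smul_mem _ _ hv, ?_⟩
  rw [norm_smul, Real.norm_of_nonneg (by positivity), div_mul_cancel₀ _ (norm_ne_zero_iff.2 hv0)]

/-- The unit ball of the renorming by which a countable boundary `f` becomes a boundary with
gaps. -/
def gapBall (f : ℕ → E →L[ℝ] ℝ) : Set E :=
  {x | ∀ n : ℕ, (1 + 1 / ((n : ℝ) + 1)) * |f n x| ≤ 1}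

theorem isClosed_gapBall (f : ℕ → E →L[ℝ] ℝ) : IsClosed (gapBall f) := by
  simp only [gapBall, Set.ofPred_forall]
  exact isClosed_iInter fun n => isClosed_le (by fun_prop) (by fun_prop)

theorem zero_mem_gapBall (f : ℕ → E →L[ℝ] ℝ) : (0 : E) ∈ gapBall f := fun n => by simp

variable {f : ℕ → E →L[ℝ] ℝ}

theorem norm_le_one_of_mem_gapBall (hf : ∀ x, ∃ n, f n x = ‖x‖) {x : E} (hx : x ∈ gapBall f) :
    ‖x‖ ≤ 1 := by
  obtain ⟨n, hn⟩ := hf x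
  have h := hx n
  rw [hn, abs_norm] at h
  have : 0 ≤ 1 / ((n : ℝ) + 1) * ‖x‖ := by positivity
  linarith

theorem exists_forall_near_add_mem_gapBall
    (hf : ∀ x, ∃ n, f n x = ‖x‖)
    (hf1 : ∀ n, ‖f n‖ ≤ 1) {x : E} (hx : x ∈ gapBall f) :
    ∃ δ > 0, ∃ m, ∀ x' ∈ gapBall f, ‖x' - x‖ < δ → ∀ h ∈ commonKer f m, ‖h‖ < δ →
      x' + h ∈ gapBall f := by
  obtain ⟨m, hm⟩ := hf x
  have hxm := hx m
  rw [hm, abs_norm] at hxm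
  set w := 1 + 1 / (((m + 1 : ℕ) : ℝ) + 1) with hw
  have hw0 : 0 < w := by positivity
  have hlt : w * ‖x‖ < 1 := by
    rcases (norm_nonneg x).eq_or_lt with h0 | h0
    · rw [← h0]; simp
    · refine lt_of_lt_of_le (mul_lt_mul_of_pos_right ?_ h0) hxm
      have := Nat.one_div_lt_one_div (α := ℝ) (Nat.lt_succ_self m)
      rw [hw]
      linarith
  refine ⟨(1 - w * ‖x‖) / (2 * w), div_pos (by linarith) (by positivity), m,
    fun x' hx' hx'x h hh hhδ n => ?_⟩
  rcases le_or_gt n m with hn | hn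
  · rw [map_add, mem_commonKer.1 hh n hn, add_zero]
    exact hx' n
  · have h1 : 1 + 1 / ((n : ℝ) + 1) ≤ w := by
      have := Nat.one_div_le_one_div (α := ℝ) (Nat.succ_le_of_lt hn)
      rw [hw]
      linarith
    have h2 : |f n (x' + h)| ≤ ‖x‖ + ‖x' - x‖ + ‖h‖ := by
      refine (abs_apply_le_norm (hf1 n) _).trans ?_
      have : x' + h = x + (x' - x) + h := by abel
      rw [this]
      exact norm_add₃_le
    calc (1 + 1 / ((n : ℝ) + 1)) * |f n (x' + h)|
        ≤ w * (‖x‖ + (1 - w * ‖x‖) / (2 * w) + (1 - w * ‖x‖) / (2 * w)) := by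
          gcongr
          linarith
      _ = 1 := by field_simp; ring

theorem IsCompact.exists_forall_add_mem_gapBall
    (hf : ∀ x, ∃ n, f n x = ‖x‖)
    (hf1 : ∀ n, ‖f n‖ ≤ 1) {K : Set E}
    (hK : IsCompact K) (hKG : K ⊆ gapBall f) :
    ∃ δ > 0, ∃ m, ∀ x ∈ K, ∀ h ∈ commonKer f m, ‖h‖ < δ → x + h ∈ gapBall f := by
  have := hK.induction_on (p := fun s => ∃ δ > 0, ∃ m, ∀ x ∈ s, x ∈ gapBall f →
    ∀ h ∈ commonKer f m, ‖h‖ < δ → x + h ∈ gapBall f) ⟨1, one_pos, 0, by simp⟩ ?_ ?_ ?_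
  · obtain ⟨δ, hδ, m, h⟩ := this
    exact ⟨δ, hδ, m, fun x hx => h x hx (hKG hx)⟩
  · rintro s t hst ⟨δ, hδ, m, h⟩
    exact ⟨δ, hδ, m, fun x hx => h x (hst hx)⟩
  · rintro s t ⟨δ, hδ, m, h⟩ ⟨δ', hδ', m', h'⟩
    refine ⟨min δ δ', lt_min hδ hδ', max m m', ?_⟩
    rintro x (hx | hx) hxG v hv hvδ
    · exact h x hx hxG v (commonKer_antitone f (le_max_left _ _) hv)
        (hvδ.trans_le (min_le_left _ _))
    · exact h' x hx hxG v (commonKer_antitone f (le_max_right _ _) hv)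
        (hvδ.trans_le (min_le_right _ _))
  · intro x hx
    obtain ⟨δ, hδ, m, h⟩ := exists_forall_near_add_mem_gapBall hf hf1 (hKG hx)
    refine ⟨Metric.ball x δ, mem_nhdsWithin_of_mem_nhds (Metric.ball_mem_nhds x hδ), δ, hδ, m,
      fun x' hx' hx'G => h x' hx'G ?_⟩
    rwa [← dist_eq_norm]

theorem exists_norm_le_two_mul_norm_add
    (hf : ∀ x, ∃ n, f n x = ‖x‖)
    (hf1 : ∀ n, ‖f n‖ ≤ 1) (F : Submodule ℝ E)
    [FiniteDimensional ℝ F] :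
    ∃ m, ∀ x ∈ F, ∀ y ∈ commonKer f m, ‖x‖ ≤ 2 * ‖x + y‖ := by
  have : ProperSpace F := FiniteDimensional.proper ℝ F
  have hK : IsCompact ((↑) '' Metric.sphere (0 : F) 1 : Set E) :=
    (isCompact_sphere (0 : F) 1).image continuous_subtype_val
  have hm : ∃ m, ∀ x ∈ ((↑) '' Metric.sphere (0 : F) 1 : Set E), ∃ n ≤ m, 1 / 2 < f n x := by
    refine hK.induction_on (p := fun s => ∃ m, ∀ x ∈ s, ∃ n ≤ m, 1 / 2 < f n x) ⟨0, by simp⟩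
      ?_ ?_ ?_
    · rintro s t hst ⟨m, h⟩
      exact ⟨m, fun x hx => h x (hst hx)⟩
    · rintro s t ⟨m, h⟩ ⟨m', h'⟩
      refine ⟨max m m', ?_⟩
      rintro x (hx | hx)
      · obtain ⟨n, hn, hnx⟩ := h x hx
        exact ⟨n, hn.trans (le_max_left _ _), hnx⟩
      · obtain ⟨n, hn, hnx⟩ := h' x hx
        exact ⟨n, hn.trans (le_max_right _ _), hnx⟩
    · rintro _ ⟨x, hx, rfl⟩
      obtain ⟨n, hn⟩ := hf (x : E)
      have hx1 : ‖(x : E)‖ = 1 := by simpa using hx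
      refine ⟨{u | 1 / 2 < f n u}, mem_nhdsWithin_of_mem_nhds ?_, n, fun u hu => ⟨n, le_rfl, hu⟩⟩
      refine (isOpen_lt continuous_const (f n).continuous).mem_nhds ?_
      change 1 / 2 < f n x
      rw [hn, hx1]
      norm_num
  obtain ⟨m, hm⟩ := hm
  refine ⟨m, fun x hx y hy => ?_⟩
  rcases (norm_nonneg x).eq_or_lt with h0 | h0
  · rw [← h0]; positivity
  obtain ⟨n, hnm, hn⟩ := hm (‖x‖⁻¹ • x) ⟨⟨‖x‖⁻¹ • x, F.smul_mem _ hx⟩, by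
    simp [norm_smul, h0.ne'], rfl⟩
  rw [map_smul, smul_eq_mul, inv_mul_eq_div, lt_div_iff₀ h0] at hn
  have h1 := apply_le_norm (hf1 n) (x + y)
  rw [map_add, mem_commonKer.1 hy n hnm, add_zero] at h1
  linarith

/-- Whenever a compact subset of `gapBall f` is given, there is a largest dyadic size `2⁻ᵏ` at
which some direction in `commonKer f m` can be added to it. -/
theorem IsCompact.exists_maximal_extension
    (hf : ∀ x, ∃ n, f n x = ‖x‖)
    (hE : ¬ FiniteDimensional ℝ E) (hf1 : ∀ n, ‖f n‖ ≤ 1)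
    {T : Set E} (hT : IsCompact T) (hTG : T ⊆ gapBall f) (m : ℕ) :
    ∃ h ∈ commonKer f m, (∀ x ∈ T, ∀ t : ℝ, |t| ≤ 1 → x + t • h ∈ gapBall f) ∧
      ∀ (k : ℕ), ∀ h' ∈ commonKer f m, ‖h'‖ = (1 / 2) ^ k →
        (∀ x ∈ T, ∀ t : ℝ, |t| ≤ 1 → x + t • h' ∈ gapBall f) → ‖h'‖ ≤ ‖h‖ := by
  classical
  have hex : ∃ k : ℕ, ∃ h ∈ commonKer f m, ‖h‖ = (1 / 2) ^ k ∧
      ∀ x ∈ T, ∀ t : ℝ, |t| ≤ 1 → x + t • h ∈ gapBall f := by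
    obtain ⟨δ, hδ, m', H⟩ := hT.exists_forall_add_mem_gapBall hf hf1 hTG
    obtain ⟨k, hk⟩ := exists_pow_lt_of_lt_one hδ (show (1 / 2 : ℝ) < 1 by norm_num)
    obtain ⟨h, hh, hhk⟩ := exists_mem_commonKer_norm_eq hE f (max m m')
      (show (0 : ℝ) ≤ (1 / 2) ^ k by positivity)
    refine ⟨k, h, commonKer_antitone f (le_max_left _ _) hh, hhk, fun x hx t ht =>
      H x hx _ (Submodule.smul_mem _ _ (commonKer_antitone f (le_max_right _ _) hh)) ?_⟩
    rw [norm_smul, hhk, Real.norm_eq_abs]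
    exact (mul_le_of_le_one_left (by positivity) ht).trans_lt hk
  obtain ⟨h, hh, hhk, hhT⟩ := Nat.find_spec hex
  refine ⟨h, hh, hhT, fun k h' hh' hk hT' => ?_⟩
  rw [hk, hhk]
  exact pow_le_pow_of_le_one (by norm_num) (by norm_num) (Nat.find_min' hex ⟨h', hh', hk, hT'⟩)

theorem exists_greedy_sequence
    (hf : ∀ x, ∃ n, f n x = ‖x‖)
    (hE : ¬ FiniteDimensional ℝ E) (hf1 : ∀ n, ‖f n‖ ≤ 1) :
    ∃ (T : ℕ → Set E) (F : ℕ → Submodule ℝ E) (m : ℕ → ℕ) (h : ℕ → E),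
      (∀ n, IsCompact (T n)) ∧ (∀ n, T n ⊆ gapBall f) ∧
      (∀ n, ∀ x ∈ F n, ∀ y ∈ commonKer f (m n), ‖x‖ ≤ 2 * ‖x + y‖) ∧
      T 0 = {0} ∧ (∀ n, T (n + 1) = {v | ∃ x ∈ T n, ∃ t : ℝ, |t| ≤ 1 ∧ x + t • h n = v}) ∧
      Monotone F ∧ Monotone m ∧ (∀ n, h n ∈ F (n + 1)) ∧ (∀ n, h n ∈ commonKer f (m n)) ∧
      ∀ n k, ∀ h' ∈ commonKer f (m n), ‖h'‖ = (1 / 2) ^ k →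
        (∀ x ∈ T n, ∀ t : ℝ, |t| ≤ 1 → x + t • h' ∈ gapBall f) → ‖h'‖ ≤ ‖h n‖ := by
  let σ := {p : Set E × Submodule ℝ E × ℕ // (IsCompact p.1 ∧ p.1 ⊆ gapBall f) ∧
    FiniteDimensional ℝ p.2.1 ∧ ∀ x ∈ p.2.1, ∀ y ∈ commonKer f p.2.2, ‖x‖ ≤ 2 * ‖x + y‖}
  have step : ∀ s : σ, ∃ (s' : σ) (h : E),
      s'.1.1 = {v | ∃ x ∈ s.1.1, ∃ t : ℝ, |t| ≤ 1 ∧ x + t • h = v} ∧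
      s.1.2.1 ≤ s'.1.2.1 ∧ s.1.2.2 ≤ s'.1.2.2 ∧ h ∈ s'.1.2.1 ∧ h ∈ commonKer f s.1.2.2 ∧
      ∀ k : ℕ, ∀ h' ∈ commonKer f s.1.2.2, ‖h'‖ = (1 / 2) ^ k →
        (∀ x ∈ s.1.1, ∀ t : ℝ, |t| ≤ 1 → x + t • h' ∈ gapBall f) → ‖h'‖ ≤ ‖h‖ := by
    rintro ⟨⟨T, F, m⟩, ⟨hT, hTG⟩, hF, hFm⟩
    obtain ⟨h, hh, hhT, hmax⟩ := hT.exists_maximal_extension hf hE hf1 hTG m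
    have hF' : FiniteDimensional ℝ ↥(F ⊔ Submodule.span ℝ {h}) := by
      have : FiniteDimensional ℝ F := hF
      infer_instance
    obtain ⟨m', hm'⟩ := exists_norm_le_two_mul_norm_add hf hf1 (F ⊔ Submodule.span ℝ {h})
    refine ⟨⟨⟨{v | ∃ x ∈ T, ∃ t : ℝ, |t| ≤ 1 ∧ x + t • h = v}, F ⊔ Submodule.span ℝ {h},
      max m m'⟩, ⟨?_, ?_⟩, hF', ?_⟩, h, rfl, le_sup_left, le_max_left _ _,
      Submodule.mem_sup_right (Submodule.mem_span_singleton_self h), hh, hmax⟩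
    · have himg : {v | ∃ x ∈ T, ∃ t : ℝ, |t| ≤ 1 ∧ x + t • h = v} =
          (fun p : E × ℝ => p.1 + p.2 • h) '' (T ×ˢ Set.Icc (-1) 1) := by
        ext v
        constructor
        · rintro ⟨x, hx, t, ht, rfl⟩
          exact ⟨(x, t), ⟨hx, abs_le.1 ht⟩, rfl⟩
        · rintro ⟨⟨x, t⟩, ⟨hx, ht⟩, rfl⟩
          exact ⟨x, hx, t, abs_le.2 ht, rfl⟩
      rw [himg]
      exact (hT.prod isCompact_Icc).image (by fun_prop)
    · rintro _ ⟨x, hx, t, ht, rfl⟩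
      exact hhT x hx t ht
    · exact fun x hx y hy => hm' x hx y (commonKer_antitone f (le_max_right _ _) hy)
  choose next h h₁ h₂ h₃ h₄ h₅ h₆ using step
  let s₀ : σ := ⟨⟨{0}, ⊥, 0⟩, ⟨isCompact_singleton, by simpa using zero_mem_gapBall f⟩,
    inferInstance, fun x hx y _ => by
      rw [(Submodule.mem_bot ℝ).1 hx, norm_zero]; positivity⟩
  let s : ℕ → σ := fun n => next^[n] s₀
  have hs : ∀ n, s (n + 1) = next (s n) := fun n => Function.iterate_succ_apply' next n s₀
  refine ⟨fun n => (s n).1.1, fun n => (s n).1.2.1, fun n => (s n).1.2.2, fun n => h (s n),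
    fun n => (s n).2.1.1, fun n => (s n).2.1.2, fun n => (s n).2.2.2, rfl, fun n => ?_,
    monotone_nat_of_le_succ fun n => ?_, monotone_nat_of_le_succ fun n => ?_, fun n => ?_,
    fun n => h₅ (s n), fun n => h₆ (s n)⟩
  · exact (congrArg (fun p : σ => p.1.1) (hs n)).trans (h₁ (s n))
  · rw [hs]; exact h₂ (s n)
  · rw [hs]; exact h₃ (s n)
  · exact (congrArg (fun p : σ => p.1.2.1) (hs n)).ge (h₄ (s n))

theorem containsC0_of_countable_boundary
    (hf : ∀ x, ∃ n, f n x = ‖x‖)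
    [CompleteSpace E] (hE : ¬ FiniteDimensional ℝ E)
    (hf1 : ∀ n, ‖f n‖ ≤ 1) : ContainsC0 E := by
  obtain ⟨T, F, m, h, hTc, hTG, hFm, hT0, hTs, hF, hm, hhF, hhm, hmax⟩ :=
    exists_greedy_sequence hf hE hf1
  have hT : ∀ n, T n = blockSums h 0 n := by
    intro n
    induction n with
    | zero =>
      ext v
      rw [hT0, Set.mem_singleton_iff]
      constructor
      · rintro rfl
        exact zero_mem_blockSums h 0 0
      · rintro ⟨c, -, rfl⟩
        simp
    | succ n ih =>
      ext v
      rw [hTs, ih]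
      constructor
      · rintro ⟨x, hx, t, ht, rfl⟩
        have := add_smul_mem_blockSums (Nat.zero_le _) n.le_succ hx
          (smul_mem_blockSums_succ h n ht) (a := 1) (by simp)
        rwa [one_smul] at this
      · rintro ⟨c, hc, rfl⟩
        exact ⟨_, ⟨c, hc, rfl⟩, c n, hc n, (Finset.sum_Ico_succ_top (Nat.zero_le n) _).symm⟩
  refine (containsC0_or_blockSums_small (h := h) (F := F) (Z := fun n => commonKer f (m n))
    (fun n v hv => norm_le_one_of_mem_gapBall hf (hTG n (hT n ▸ hv)))
    (fun n i hi => hF hi (hhF i)) (fun n i hi => commonKer_antitone f (hm hi) (hhm i))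
    hFm).resolve_right fun hsmall => ?_
  have htot : TotallyBounded (⋃ n, T n) := by
    refine Metric.totallyBounded_iff.2 fun ε hε => ?_
    obtain ⟨n, hn⟩ := hsmall (ε / 2) (by positivity)
    obtain ⟨t, htfin, ht⟩ := Metric.totallyBounded_iff.1 (hTc n).totallyBounded (ε / 2)
      (by positivity)
    refine ⟨t, htfin, Set.iUnion_subset fun l v hv => ?_⟩
    have hvn : ∃ v' ∈ T n, ‖v - v'‖ < ε / 2 := by
      rw [hT] at hv
      obtain ⟨c, hc, rfl⟩ := hv
      rcases le_total n l with hnl | hln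
      · refine ⟨∑ i ∈ Finset.Ico 0 n, c i • h i, hT n ▸ ⟨c, hc, rfl⟩, ?_⟩
        rw [← Finset.sum_Ico_consecutive _ (Nat.zero_le n) hnl, add_sub_cancel_left]
        exact hn l hnl _ ⟨c, hc, rfl⟩
      · refine ⟨∑ i ∈ Finset.Ico 0 l, c i • h i, ?_, by simpa using hε⟩
        have := add_smul_mem_blockSums (Nat.zero_le _) hln ⟨c, hc, rfl⟩
          (zero_mem_blockSums h l n) (a := 0) (by simp)
        rwa [smul_zero, add_zero, ← hT] at this
    obtain ⟨v', hv', hvv'⟩ := hvn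
    obtain ⟨y, hy, hy'⟩ := Set.mem_iUnion₂.1 (ht hv')
    refine Set.mem_iUnion₂.2 ⟨y, hy, ?_⟩
    rw [← dist_eq_norm] at hvv'
    have := dist_triangle v v' y
    rw [Metric.mem_ball] at hy' ⊢
    linarith
  have hK : IsCompact (closure (⋃ n, T n)) :=
    htot.closure.isCompact_of_isClosed isClosed_closure
  obtain ⟨δ, hδ, m', H⟩ := hK.exists_forall_add_mem_gapBall hf hf1
    (closure_minimal (Set.iUnion_subset hTG) (isClosed_gapBall f))
  obtain ⟨k, hk⟩ := exists_pow_lt_of_lt_one hδ (show (1 / 2 : ℝ) < 1 by norm_num)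
  obtain ⟨n, hn⟩ := hsmall ((1 / 2) ^ k) (by positivity)
  obtain ⟨h', hh', hhk⟩ := exists_mem_commonKer_norm_eq hE f (max (m n) m')
    (show (0 : ℝ) ≤ (1 / 2) ^ k by positivity)
  have hle := hmax n k h' (commonKer_antitone f (le_max_left _ _) hh') hhk fun x hx t ht =>
    H x (subset_closure (Set.mem_iUnion.2 ⟨n, hx⟩)) _
      (Submodule.smul_mem _ _ (commonKer_antitone f (le_max_right _ _) hh')) (by
        rw [norm_smul, hhk, Real.norm_eq_abs]
        exact (mul_le_of_le_one_left (by positivity) ht).trans_lt hk)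
  have hlt := hn (n + 1) n.le_succ _ (smul_mem_blockSums_succ h n (t := 1) (by simp))
  rw [one_smul] at hlt
  linarith

end CountableBoundary

theorem exists_separable_closed_submodule {E : Type*} [NormedAddCommGroup E] [NormedSpace ℝ E]
    {S : Submodule ℝ E} (hS : IsClosed (S : Set E)) (hinf : ¬ FiniteDimensional ℝ S) :
    ∃ N ≤ S, IsClosed (N : Set E) ∧ TopologicalSpace.SeparableSpace N ∧
      ¬ FiniteDimensional ℝ N := by
  let b := Module.Basis.ofVectorSpace ℝ S
  have hbi : Infinite (Module.Basis.ofVectorSpaceIndex ℝ S) := by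
    by_contra hfin
    rw [not_infinite_iff_finite] at hfin
    exact hinf (Module.Finite.of_basis b)
  let e := Infinite.natEmbedding (Module.Basis.ofVectorSpaceIndex ℝ S)
  let v : ℕ → E := fun n => (b (e n) : E)
  have hv : LinearIndependent ℝ v :=
    (b.linearIndependent.comp e e.injective).map' S.subtype S.ker_subtype
  refine ⟨(Submodule.span ℝ (Set.range v)).topologicalClosure, ?_,
    Submodule.isClosed_topologicalClosure _, ?_, fun hfin => ?_⟩
  · refine Submodule.topologicalClosure_minimal _ (Submodule.span_le.2 ?_) hS
    rintro _ ⟨n, rfl⟩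
    exact (b (e n)).2
  · have := ((Set.countable_range v).isSeparable.span (R := ℝ)).closure
    exact this.separableSpace
  · have hspan : FiniteDimensional ℝ (Submodule.span ℝ (Set.range v)) :=
      Submodule.finiteDimensional_of_le (Submodule.le_topologicalClosure _)
    have : Finite ℕ := (Module.Basis.span hv).linearIndependent.finite_of_isNoetherian
    exact not_finite ℕ

/-- Isomorphically polyhedral spaces are `c₀`-saturated: every infinite-dimensional
closed subspace contains an isomorphic copy of `c₀`. -/
theorem isomorphically_polyhedral_c0_saturated
    (X : Type u) [NormedAddCommGroup X] [NormedSpace ℝ X] [CompleteSpace X]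
    (hX : IsIsomorphicallyPolyhedral X) :
    ∀ S : Subspace ℝ X, IsClosed (S : Set X) → ¬ FiniteDimensional ℝ S →
      ∃ f : C₀(ℕ, ℝ) →L[ℝ] S, ∃ c : ℝ, 0 < c ∧ ∀ y : C₀(ℕ, ℝ), c * ‖y‖ ≤ ‖f y‖ := by
  obtain ⟨Y, _, _, hY, ⟨e⟩⟩ := hX
  intro S hS hinf
  have : CompleteSpace Y :=
    (completeSpace_congr (e := e.toEquiv) e.isUniformEmbedding).1 inferInstance
  have hS' : IsClosed ((S.comap (e.symm : Y →ₗ[ℝ] X) : Submodule ℝ Y) : Set Y) :=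
    hS.preimage e.symm.continuous
  have hinf' : ¬ FiniteDimensional ℝ (S.comap (e.symm : Y →ₗ[ℝ] X)) := by
    intro hfin
    refine hinf (FiniteDimensional.of_injective (V₂ := S.comap (e.symm : Y →ₗ[ℝ] X))
      (((e : X →ₗ[ℝ] Y).comp S.subtype).codRestrict _ fun x => by simp) fun x y hxy => ?_)
    exact Subtype.ext (e.injective (congrArg Subtype.val hxy))
  obtain ⟨N, hNS, hN, hsep, hNinf⟩ := exists_separable_closed_submodule hS' hinf'
  have : CompleteSpace N := hN.completeSpace_coe
  obtain ⟨f, hf1, hf⟩ := (hY.normLocallyLinearOnRays.submodule N).exists_countable_boundary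
  obtain ⟨J, c, hc, hJ⟩ := containsC0_of_countable_boundary hf hNinf hf1
  let I : N →L[ℝ] S := ((e.symm : Y →L[ℝ] X).comp N.subtypeL).codRestrict S fun x => hNS x.2
  have hI : ∀ x : N, ‖x‖ ≤ (‖(e : X →L[ℝ] Y)‖ + 1) * ‖I x‖ := by
    intro x
    have h := (e : X →L[ℝ] Y).le_opNorm (I x : X)
    have h1 : (e : X →L[ℝ] Y) (I x : X) = (x : Y) := e.apply_symm_apply (x : Y)
    rw [h1] at h
    have h2 := norm_nonneg (I x)
    simp only [Submodule.coe_norm] at h h2 ⊢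
    linarith
  refine ⟨I.comp J, c / (‖(e : X →L[ℝ] Y)‖ + 1), by positivity, fun y => ?_⟩
  rw [div_mul_eq_mul_div, div_le_iff₀ (by positivity), mul_comm ‖_‖]
  exact (hJ y).trans (hI (J y))
end
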